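/- If a C^{1+bv} action of Z^d on [0,1] has no parabolic global fixed point in the open interval (0,1) and its image group is not cyclic, then the action embeds into a C^1 flow. -/

import Mathlib

open Set MeasureTheory Filter Topology

noncomputable section

/-- An orientation-preserving `C¹` diffeomorphism of the interval `[0,1]`, recorded together
with its derivative, and extended by the identity outside of `[0,1]`. -/
structure C1Diffeo : Type where
  toFun : ℝ → ℝ
  derivFun : ℝ → ℝ
  map_zero : toFun 0 = 0
  map_one : toFun 1 = 1
  fixes_outside : ∀ x : ℝ, x ∉ Icc (0:ℝ) 1 → toFun x = x
  bijOn : BijOn toFun (Icc (0:ℝ) 1) (Icc (0:ℝ) 1)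
  hasDeriv : ∀ x ∈ Icc (0:ℝ) 1, HasDerivWithinAt toFun (derivFun x) (Icc (0:ℝ) 1) x
  derivFun_cont : ContinuousOn derivFun (Icc (0:ℝ) 1)
  derivFun_pos : ∀ x ∈ Icc (0:ℝ) 1, 0 < derivFun x

/-- A `C^{1+bv}` diffeomorphism of `[0,1]`: a `C¹` diffeomorphism such that `log Df` has
finite total variation. -/
structure C1bvDiffeo extends C1Diffeo where
  logDeriv_bv : BoundedVariationOn (fun x => Real.log (derivFun x)) (Icc (0:ℝ) 1)

/-- An action of `ℤᵈ` on `[0,1]` by orientation-preserving `C^{1+bv}` diffeomorphisms. -/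
structure ZdAction1bv (d : ℕ) where
  elt : (Fin d → ℤ) → C1bvDiffeo
  elt_add : ∀ a b : Fin d → ℤ, ∀ x : ℝ,
    (elt (a + b)).toFun x = (elt a).toFun ((elt b).toFun x)
  elt_zero : ∀ x : ℝ, (elt 0).toFun x = x

/-- `Φ`, together with its spatial derivative `Φ'`, is a `C¹` flow on the one-dimensional
manifold-with-boundary `s ⊆ ℝ` (extended by the identity outside of `s`): a continuous group
homomorphism from `(ℝ,+)` to the orientation-preserving `C¹` diffeomorphisms of `s` endowed
with the `C¹` topology. -/
def IsC1FlowOn (s : Set ℝ) (Φ Φ' : ℝ → ℝ → ℝ) : Prop :=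
  (∀ x : ℝ, Φ 0 x = x) ∧
  (∀ t u : ℝ, ∀ x : ℝ, Φ (t + u) x = Φ t (Φ u x)) ∧
  (∀ t : ℝ, ∀ x ∉ s, Φ t x = x) ∧
  (∀ t : ℝ, BijOn (Φ t) s s) ∧
  (∀ t : ℝ, ∀ x ∈ s, HasDerivWithinAt (Φ t) (Φ' t x) s x) ∧
  (∀ t : ℝ, ContinuousOn (Φ' t) s) ∧
  (∀ t : ℝ, ∀ x ∈ s, 0 < Φ' t x) ∧
  (∀ t₀ : ℝ, ∀ K : Set ℝ, IsCompact K → K ⊆ s → ∀ ε > (0:ℝ), ∃ δ > (0:ℝ), ∀ t : ℝ,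
    |t - t₀| < δ → ∀ x ∈ K,
      |Φ t x - Φ t₀ x| + |Real.log (Φ' t x) - Real.log (Φ' t₀ x)| < ε)


namespace ZdAction1bv

variable {d : ℕ} (ρ : ZdAction1bv d)

/-- The action of `a` on the line. -/
def act (a : Fin d → ℤ) (x : ℝ) : ℝ := (ρ.elt a).toFun x

/-- The derivative of the action of `a`. -/
def dd (a : Fin d → ℤ) (x : ℝ) : ℝ := (ρ.elt a).derivFun x

/-- The logarithm of the derivative of the action of `a`. -/
def ll (a : Fin d → ℤ) (x : ℝ) : ℝ := Real.log (ρ.dd a x)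

lemma act_add (a b : Fin d → ℤ) (x : ℝ) : ρ.act (a + b) x = ρ.act a (ρ.act b x) :=
  ρ.elt_add a b x

lemma act_zero (x : ℝ) : ρ.act 0 x = x := ρ.elt_zero x

lemma act_neg_act (a : Fin d → ℤ) (x : ℝ) : ρ.act (-a) (ρ.act a x) = x := by
  rw [← act_add, neg_add_cancel, act_zero]

lemma act_act_neg (a : Fin d → ℤ) (x : ℝ) : ρ.act a (ρ.act (-a) x) = x := by
  rw [← act_add, add_neg_cancel, act_zero]

lemma act_comm (a b : Fin d → ℤ) (x : ℝ) : ρ.act a (ρ.act b x) = ρ.act b (ρ.act a x) := by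
  rw [← act_add, add_comm, act_add]

lemma act_at_zero (a : Fin d → ℤ) : ρ.act a 0 = 0 := (ρ.elt a).map_zero

lemma act_at_one (a : Fin d → ℤ) : ρ.act a 1 = 1 := (ρ.elt a).map_one

lemma act_mem (a : Fin d → ℤ) {x : ℝ} (hx : x ∈ Icc (0:ℝ) 1) : ρ.act a x ∈ Icc (0:ℝ) 1 :=
  (ρ.elt a).bijOn.mapsTo hx

lemma act_outside (a : Fin d → ℤ) {x : ℝ} (hx : x ∉ Icc (0:ℝ) 1) : ρ.act a x = x :=
  (ρ.elt a).fixes_outside x hx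

lemma hasDeriv (a : Fin d → ℤ) {x : ℝ} (hx : x ∈ Icc (0:ℝ) 1) :
    HasDerivWithinAt (ρ.act a) (ρ.dd a x) (Icc (0:ℝ) 1) x :=
  (ρ.elt a).hasDeriv x hx

lemma dd_pos (a : Fin d → ℤ) {x : ℝ} (hx : x ∈ Icc (0:ℝ) 1) : 0 < ρ.dd a x :=
  (ρ.elt a).derivFun_pos x hx

lemma dd_cont (a : Fin d → ℤ) : ContinuousOn (ρ.dd a) (Icc (0:ℝ) 1) :=
  (ρ.elt a).derivFun_cont

lemma ll_cont (a : Fin d → ℤ) : ContinuousOn (ρ.ll a) (Icc (0:ℝ) 1) :=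
  (ρ.dd_cont a).log fun _ hx => (ρ.dd_pos a hx).ne'

lemma ll_bv (a : Fin d → ℤ) : BoundedVariationOn (ρ.ll a) (Icc (0:ℝ) 1) :=
  (ρ.elt a).logDeriv_bv

lemma exp_ll (a : Fin d → ℤ) {x : ℝ} (hx : x ∈ Icc (0:ℝ) 1) :
    Real.exp (ρ.ll a x) = ρ.dd a x := Real.exp_log (ρ.dd_pos a hx)

lemma hasDerivAt' (a : Fin d → ℤ) {x : ℝ} (hx : x ∈ Ioo (0:ℝ) 1) :
    HasDerivAt (ρ.act a) (ρ.dd a x) x :=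
  (ρ.hasDeriv a (Ioo_subset_Icc_self hx)).hasDerivAt (Icc_mem_nhds hx.1 hx.2)

lemma act_strictMono (a : Fin d → ℤ) : StrictMono (ρ.act a) := by
  have h1 : StrictMonoOn (ρ.act a) (Icc (0:ℝ) 1) := by
    apply strictMonoOn_of_deriv_pos (convex_Icc 0 1)
    · intro x hx
      exact (ρ.hasDeriv a hx).continuousWithinAt
    · intro x hx
      rw [interior_Icc] at hx
      rw [(ρ.hasDerivAt' a hx).deriv]
      exact ρ.dd_pos a (Ioo_subset_Icc_self hx)
  intro x y hxy
  by_cases hx : x ∈ Icc (0:ℝ) 1 <;> by_cases hy : y ∈ Icc (0:ℝ) 1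
  · exact h1 hx hy hxy
  · rw [ρ.act_outside a hy]
    have := ρ.act_mem a hx
    simp only [mem_Icc, not_and_or, not_le] at *
    rcases hy with hy | hy <;> linarith
  · rw [ρ.act_outside a hx]
    have := ρ.act_mem a hy
    simp only [mem_Icc, not_and_or, not_le] at *
    rcases hx with hx | hx <;> linarith
  · rwa [ρ.act_outside a hx, ρ.act_outside a hy]

lemma act_continuous (a : Fin d → ℤ) : Continuous (ρ.act a) :=
  (ρ.act_strictMono a).monotone.continuous_of_surjective
    fun y => ⟨ρ.act (-a) y, ρ.act_act_neg a y⟩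

lemma dd_add (a b : Fin d → ℤ) {x : ℝ} (hx : x ∈ Icc (0:ℝ) 1) :
    ρ.dd (a + b) x = ρ.dd a (ρ.act b x) * ρ.dd b x := by
  have h1 := ρ.hasDeriv (a + b) hx
  have h2 := (ρ.hasDeriv a (ρ.act_mem b hx)).scomp x (ρ.hasDeriv b hx)
    (fun y hy => ρ.act_mem b hy)
  have h3 : HasDerivWithinAt (ρ.act (a + b)) (ρ.dd b x • ρ.dd a (ρ.act b x)) (Icc (0:ℝ) 1) x := by
    refine h2.congr_of_mem (fun y _ => ρ.act_add a b y) hx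
  have := (uniqueDiffOn_Icc (zero_lt_one' ℝ) x hx).eq_deriv _ h1 h3
  rw [this, smul_eq_mul, mul_comm]

lemma ll_add (a b : Fin d → ℤ) {x : ℝ} (hx : x ∈ Icc (0:ℝ) 1) :
    ρ.ll (a + b) x = ρ.ll a (ρ.act b x) + ρ.ll b x := by
  unfold ll
  rw [ρ.dd_add a b hx, Real.log_mul (ρ.dd_pos a (ρ.act_mem b hx)).ne' (ρ.dd_pos b hx).ne']

lemma ll_zero {x : ℝ} (hx : x ∈ Icc (0:ℝ) 1) : ρ.ll 0 x = 0 := by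
  have := ρ.ll_add 0 0 hx
  rw [add_zero, ρ.act_zero] at this
  linarith

lemma ll_neg (a : Fin d → ℤ) {x : ℝ} (hx : x ∈ Icc (0:ℝ) 1) :
    ρ.ll (-a) x = - ρ.ll a (ρ.act (-a) x) := by
  have := ρ.ll_add a (-a) hx
  rw [add_neg_cancel, ρ.ll_zero hx] at this
  linarith

lemma ll_nsmul (a : Fin d → ℤ) (n : ℕ) {x : ℝ} (hx : x ∈ Icc (0:ℝ) 1) :
    ρ.ll (n • a) x = ∑ k ∈ Finset.range n, ρ.ll a (ρ.act (k • a) x) := by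
  induction n with
  | zero => simp [ρ.ll_zero hx]
  | succ n ih =>
    rw [Finset.sum_range_succ, ← ih, succ_nsmul', ρ.ll_add _ _ hx, add_comm]

lemma act_succ (a : Fin d → ℤ) (n : ℕ) (x : ℝ) :
    ρ.act ((n + 1) • a) x = ρ.act a (ρ.act (n • a) x) := by
  rw [succ_nsmul', act_add]

lemma seq_mono (a : Fin d → ℤ) {x : ℝ} (h : x ≤ ρ.act a x) :
    Monotone fun n : ℕ => ρ.act (n • a) x := by
  apply monotone_nat_of_le_succ
  intro n
  rw [succ_nsmul, act_add]
  exact (ρ.act_strictMono _).monotone h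

lemma seq_anti (a : Fin d → ℤ) {x : ℝ} (h : ρ.act a x ≤ x) :
    Antitone fun n : ℕ => ρ.act (n • a) x := by
  apply antitone_nat_of_succ_le
  intro n
  rw [succ_nsmul, act_add]
  exact (ρ.act_strictMono _).monotone h

lemma seq_mono_or (a : Fin d → ℤ) (x : ℝ) :
    (Monotone fun n : ℕ => ρ.act (n • a) x) ∨ (Antitone fun n : ℕ => ρ.act (n • a) x) :=
  (le_total x (ρ.act a x)).imp (ρ.seq_mono a) (ρ.seq_anti a)

lemma seq_lim (a : Fin d → ℤ) {x : ℝ} (hx : x ∈ Icc (0:ℝ) 1) :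
    ∃ p ∈ Icc (0:ℝ) 1, Tendsto (fun n : ℕ => ρ.act (n • a) x) atTop (𝓝 p) ∧ ρ.act a p = p := by
  have hm : ∀ n : ℕ, ρ.act (n • a) x ∈ Icc (0:ℝ) 1 := fun n => ρ.act_mem _ hx
  have : ∃ p, Tendsto (fun n : ℕ => ρ.act (n • a) x) atTop (𝓝 p) := by
    rcases ρ.seq_mono_or a x with h | h
    · exact ⟨_, tendsto_atTop_ciSup h ⟨1, by rintro _ ⟨n, rfl⟩; exact (hm n).2⟩⟩
    · exact ⟨_, tendsto_atTop_ciInf h ⟨0, by rintro _ ⟨n, rfl⟩; exact (hm n).1⟩⟩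
  obtain ⟨p, hp⟩ := this
  refine ⟨p, isClosed_Icc.mem_of_tendsto hp (Eventually.of_forall hm), hp, ?_⟩
  have h1 := hp.comp (tendsto_add_atTop_nat 1)
  have h2 := ((ρ.act_continuous a).tendsto p).comp hp
  refine tendsto_nhds_unique h2 (h1.congr fun n => ?_)
  simp only [Function.comp]
  rw [act_succ]

lemma var_seq (u : ℝ → ℝ) (s : ℕ → ℝ) (hs : Monotone s ∨ Antitone s) (n : ℕ) :
    ∑ k ∈ Finset.range n, eVariationOn u (uIcc (s k) (s (k + 1)))
      = eVariationOn u (uIcc (s 0) (s n)) := by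
  rcases hs with hs | hs
  · rw [uIcc_of_le (hs (Nat.zero_le n)), ← eVariationOn.sum' u hs]
    refine Finset.sum_congr rfl fun k _ => ?_
    rw [uIcc_of_le (hs (Nat.le_succ k))]
  · induction n with
    | zero => simp
    | succ n ih =>
      rw [Finset.sum_range_succ, ih, uIcc_of_ge (hs (Nat.zero_le n)), uIcc_of_ge (hs (Nat.le_succ n)),
        uIcc_of_ge (hs (Nat.zero_le (n+1))), add_comm]
      have := eVariationOn.Icc_add_Icc u (s := univ) (hs (Nat.le_succ n)) (hs (Nat.zero_le n))
        (mem_univ _)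
      simpa using this

lemma act_uIcc (a : Fin d → ℤ) {x y z : ℝ} (h : x ∈ uIcc y z) :
    ρ.act a x ∈ uIcc (ρ.act a y) (ρ.act a z) :=
  (ρ.act_strictMono a).monotone.mapsTo_uIcc h

/-- Distortion estimate. -/
lemma dist_est (f g : Fin d → ℤ) {x z p : ℝ} (hz : z ∈ Icc (0:ℝ) 1)
    (hx : x ∈ uIcc z (ρ.act f z)) (hy : ρ.act g x ∈ uIcc z (ρ.act f z))
    (hp : Tendsto (fun n : ℕ => ρ.act (n • f) z) atTop (𝓝 p)) :
    |ρ.ll g x - ρ.ll g p| ≤ (eVariationOn (ρ.ll f) (uIcc z p)).toReal := by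
  have hz' : ∀ n : ℕ, ρ.act (n • f) z ∈ Icc (0:ℝ) 1 := fun n => ρ.act_mem _ hz
  have hpI : p ∈ Icc (0:ℝ) 1 := isClosed_Icc.mem_of_tendsto hp (Eventually.of_forall hz')
  have hsub : uIcc z (ρ.act f z) ⊆ Icc (0:ℝ) 1 := by
    exact ordConnected_Icc.uIcc_subset hz (ρ.act_mem f hz)
  have hxI := hsub hx
  have hyI := hsub hy
  have key : ∀ (w : ℝ), w ∈ uIcc z (ρ.act f z) → ∀ k : ℕ,
      ρ.act (k • f) w ∈ uIcc (ρ.act (k • f) z) (ρ.act ((k + 1) • f) z) := by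
    intro w hw k
    rw [succ_nsmul, act_add]
    exact ρ.act_uIcc _ hw
  have hxp : Tendsto (fun n : ℕ => ρ.act (n • f) x) atTop (𝓝 p) := by
    have hp1 : Tendsto (fun n : ℕ => ρ.act ((n + 1) • f) z) atTop (𝓝 p) :=
      hp.comp (tendsto_add_atTop_nat 1)
    have hmin := hp.min hp1
    have hmax := hp.max hp1
    rw [min_self] at hmin
    rw [max_self] at hmax
    exact tendsto_of_tendsto_of_tendsto_of_le_of_le hmin hmax
      (fun n => (key x hx n).1) (fun n => (key x hx n).2)
  have hV : eVariationOn (ρ.ll f) (uIcc z p) ≠ ⊤ :=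
    (ρ.ll_bv f).mono (ordConnected_Icc.uIcc_subset hz hpI)
  have hbound : ∀ n : ℕ, |ρ.ll g x - ρ.ll g (ρ.act (n • f) x)|
      ≤ (eVariationOn (ρ.ll f) (uIcc z p)).toReal := by
    intro n
    have e1 : ρ.ll g x - ρ.ll g (ρ.act (n • f) x)
        = ∑ k ∈ Finset.range n, (ρ.ll f (ρ.act (k • f) x) - ρ.ll f (ρ.act (k • f) (ρ.act g x))) := by
      have h1 := ρ.ll_add g (n • f) hxI
      have h2 := ρ.ll_add (n • f) g hxI
      rw [add_comm] at h1
      rw [Finset.sum_sub_distrib, ← ρ.ll_nsmul f n hxI, ← ρ.ll_nsmul f n hyI]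
      linarith
    have hzn : uIcc z (ρ.act (n • f) z) ⊆ uIcc z p := by
      apply uIcc_subset_uIcc_left
      rcases ρ.seq_mono_or f z with h | h
      · have h0 := h (Nat.zero_le n)
        simp only [zero_nsmul, act_zero] at h0
        have h1 := h.ge_of_tendsto hp n
        rw [uIcc_of_le (h0.trans h1)]
        exact ⟨h0, h1⟩
      · have h0 := h (Nat.zero_le n)
        simp only [zero_nsmul, act_zero] at h0
        have h1 := h.le_of_tendsto hp n
        rw [uIcc_of_ge (h1.trans h0)]
        exact ⟨h1, h0⟩
    have e2 : ENNReal.ofReal |ρ.ll g x - ρ.ll g (ρ.act (n • f) x)|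
        ≤ eVariationOn (ρ.ll f) (uIcc z p) := by
      calc ENNReal.ofReal |ρ.ll g x - ρ.ll g (ρ.act (n • f) x)|
          ≤ ENNReal.ofReal (∑ k ∈ Finset.range n,
            |ρ.ll f (ρ.act (k • f) x) - ρ.ll f (ρ.act (k • f) (ρ.act g x))|) := by
            rw [e1]
            exact ENNReal.ofReal_le_ofReal (Finset.abs_sum_le_sum_abs _ _)
        _ = ∑ k ∈ Finset.range n, edist (ρ.ll f (ρ.act (k • f) x))
              (ρ.ll f (ρ.act (k • f) (ρ.act g x))) := by
            rw [ENNReal.ofReal_sum_of_nonneg (fun _ _ => abs_nonneg _)]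
            refine Finset.sum_congr rfl fun k _ => ?_
            rw [edist_dist, Real.dist_eq]
        _ ≤ ∑ k ∈ Finset.range n,
              eVariationOn (ρ.ll f) (uIcc (ρ.act (k • f) z) (ρ.act ((k + 1) • f) z)) :=
            Finset.sum_le_sum fun k _ => eVariationOn.edist_le _ (key x hx k) (key _ hy k)
        _ = eVariationOn (ρ.ll f) (uIcc z (ρ.act (n • f) z)) := by
            rw [var_seq _ (fun n : ℕ => ρ.act (n • f) z) (ρ.seq_mono_or f z)]
            simp [act_zero]
        _ ≤ _ := eVariationOn.mono _ hzn
    exact (ENNReal.ofReal_le_iff_le_toReal hV).1 e2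
  have hlim : Tendsto (fun n : ℕ => |ρ.ll g x - ρ.ll g (ρ.act (n • f) x)|) atTop
      (𝓝 |ρ.ll g x - ρ.ll g p|) := by
    apply Tendsto.abs
    apply tendsto_const_nhds.sub
    have := (ρ.ll_cont g p hpI).tendsto
    exact this.comp (tendsto_nhdsWithin_iff.2 ⟨hxp, Eventually.of_forall fun n => ρ.act_mem _ hxI⟩)
  exact le_of_tendsto' hlim hbound

end ZdAction1bv

/-- An archimedean property for germs of commuting maps at `0`. -/
lemma arch_core {A : Type*} [AddCommGroup A] (ψ : A → ℝ → ℝ) (δ : A →+ ℝ)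
    (hadd : ∀ a b r, ψ (a + b) r = ψ a (ψ b r)) (hzero : ∀ r, ψ 0 r = r)
    (hmono : ∀ a, StrictMono (ψ a)) (hcont : ∀ a, Continuous (ψ a)) (h0 : ∀ a, ψ a 0 = 0)
    (hlim : ∀ a, Tendsto (fun r => ψ a r / r) (𝓝[>] 0) (𝓝 (Real.exp (δ a))))
    (hdich : ∀ a, ∀ r ∈ Ioo (0:ℝ) 1, ψ a r = r → ∀ s ∈ Ioo (0:ℝ) 1, ψ a s = s)
    (g : A) (hg : ψ g (1/2) ≠ 1/2) (hδ : δ g = 0) : ∀ h, δ h = 0 := by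
  have half : (1/2 : ℝ) ∈ Ioo (0:ℝ) 1 := by constructor <;> norm_num
  -- sign constancy
  have hsign : ∀ a, ∀ r ∈ Ioo (0:ℝ) 1, ψ a r < r → ∀ s ∈ Ioo (0:ℝ) 1, ψ a s < s := by
    intro a r hr hlt s hs
    by_contra hcon
    push Not at hcon
    have hc : ContinuousOn (fun r => ψ a r - r) (Ioo (0:ℝ) 1) :=
      ((hcont a).sub continuous_id).continuousOn
    have := isPreconnected_Ioo.intermediate_value hr hs hc
    have h00 : (0:ℝ) ∈ Icc (ψ a r - r) (ψ a s - s) := ⟨by linarith, by linarith⟩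
    obtain ⟨w, hw, hw0⟩ := this h00
    have := hdich a w hw (by simp only at hw0; linarith) r hr
    linarith
  have hle : ∀ a, (∀ s ∈ Ioo (0:ℝ) 1, ψ a s < s) → δ a ≤ 0 := by
    intro a ha
    rw [← Real.exp_le_one_iff]
    refine le_of_tendsto (hlim a) ?_
    filter_upwards [Ioo_mem_nhdsGT (zero_lt_one' ℝ)] with r hr
    rw [div_le_one hr.1]
    exact (ha r hr).le
  have hlt : ∀ a, δ a < 0 → ∀ s ∈ Ioo (0:ℝ) 1, ψ a s < s := by
    intro a ha
    rw [← Real.exp_lt_one_iff] at ha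
    have h1 := (hlim a).eventually (gt_mem_nhds ha)
    obtain ⟨r, hr1, hr⟩ := (h1.and (Ioo_mem_nhdsGT (zero_lt_one' ℝ))).exists
    rw [div_lt_one hr.1] at hr1
    exact hsign a r hr hr1
  have main : ∀ g h, (∀ s ∈ Ioo (0:ℝ) 1, ψ g s < s) → δ g = 0 → δ h < 0 → False := by
    intro g h hg hδg hδh
    have hpos : ∀ a r, 0 < r → 0 < ψ a r := fun a r hr => by
      have := hmono a hr
      rwa [h0] at this
    have hn : ∀ n : ℕ, ψ (n • g) (1/2) ∈ Ioc (0:ℝ) (1/2) := by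
      intro n
      refine ⟨hpos _ _ half.1, ?_⟩
      induction n with
      | zero => simp [hzero]
      | succ n ih =>
        rw [succ_nsmul', hadd]
        have := hpos (n • g) _ half.1
        have := hg (ψ (n • g) (1/2)) ⟨this, by linarith⟩
        linarith
    have hanti : Antitone fun n : ℕ => ψ (n • g) (1/2) := by
      apply antitone_nat_of_succ_le
      intro n
      rw [succ_nsmul', hadd]
      exact (hg _ ⟨(hn n).1, by linarith [(hn n).2]⟩).le
    have hL := tendsto_atTop_ciInf hanti ⟨0, by rintro _ ⟨n, rfl⟩; exact (hn n).1.le⟩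
    set L := ⨅ n : ℕ, ψ (n • g) (1/2)
    have hL0 : 0 ≤ L := ge_of_tendsto' hL fun n => (hn n).1.le
    have hL1 : L ≤ 1/2 := le_of_tendsto' hL fun n => (hn n).2
    have hfix : ψ g L = L := by
      have h1 := hL.comp (tendsto_add_atTop_nat 1)
      have h2 := ((hcont g).tendsto L).comp hL
      refine tendsto_nhds_unique h2 (h1.congr fun n => ?_)
      simp only [Function.comp]
      rw [succ_nsmul', hadd]
    have hLz : L = 0 := by
      by_contra hne
      have hp : 0 < L := lt_of_le_of_ne hL0 (Ne.symm hne)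
      have := hg L ⟨hp, by linarith⟩
      linarith
    rw [hLz] at hL
    obtain ⟨n, hnn⟩ := (hL.eventually (gt_mem_nhds (hpos h _ half.1))).exists
    have hk : ψ (-h + n • g) (1/2) < 1/2 := by
      rw [hadd]
      calc ψ (-h) (ψ (n • g) (1/2)) < ψ (-h) (ψ h (1/2)) := hmono _ hnn
        _ = 1/2 := by rw [← hadd, neg_add_cancel, hzero]
    have := hle _ (hsign _ _ half hk)
    rw [map_add, map_neg, map_nsmul, hδg] at this
    simp at this
    linarith
  have main2 : ∀ g, ψ g (1/2) < 1/2 → δ g = 0 → ∀ h, δ h = 0 := by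
    intro g hg hδg h
    rcases lt_trichotomy (δ h) 0 with hh | hh | hh
    · exact (main g h (hsign g _ half hg) hδg hh).elim
    · exact hh
    · exact (main g (-h) (hsign g _ half hg) hδg (by rw [map_neg]; linarith)).elim
  rcases lt_or_gt_of_ne hg with hg | hg
  · exact main2 g hg hδ
  · refine main2 (-g) ?_ (by rw [map_neg, hδ, neg_zero])
    have := hmono (-g) hg
    rwa [← hadd, neg_add_cancel, hzero] at this

/-- Connectedness argument on punctured neighborhoods. -/
lemma punctured_conn (P : ℝ → Prop)
    (h : ∀ x ∈ Ioo (0:ℝ) 1, (∀ᶠ y in 𝓝[≠] x, P y) ∨ (∀ᶠ y in 𝓝[≠] x, ¬ P y)) :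
    (∀ x ∈ Ioo (0:ℝ) 1, ∀ᶠ y in 𝓝[≠] x, P y) ∨ (∀ x ∈ Ioo (0:ℝ) 1, ∀ᶠ y in 𝓝[≠] x, ¬ P y) := by
  have hop : ∀ Q : ℝ → Prop, IsOpen {x : ℝ | ∀ᶠ y in 𝓝[≠] x, Q y} := by
    intro Q
    rw [isOpen_iff_mem_nhds]
    intro x hx
    have h1 : ∀ᶠ y in 𝓝[≠] x, ∀ᶠ z in 𝓝 y, Q z := eventually_nhdsNE_eventually_nhds_iff.2 hx
    rw [eventually_nhdsWithin_iff] at h1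
    filter_upwards [h1] with y hy
    by_cases hyx : y = x
    · rw [hyx]; exact hx
    · exact eventually_nhdsWithin_of_eventually_nhds (hy hyx)
  by_contra hcon
  rw [not_or] at hcon
  simp only [not_forall] at hcon
  obtain ⟨⟨x, hx, hxP⟩, ⟨y, hy, hyP⟩⟩ := hcon
  have hx' := (h x hx).resolve_left hxP
  have hy' := (h y hy).resolve_right hyP
  obtain ⟨z, -, hz1, hz2⟩ := (isPreconnected_Ioo (a := (0:ℝ)) (b := 1)) _ _
    (hop P) (hop fun y => ¬ P y) (fun x hx => h x hx) ⟨y, hy, hy'⟩ ⟨x, hx, hx'⟩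
  have hz1 : ∀ᶠ y in 𝓝[≠] z, P y := hz1
  have hz2 : ∀ᶠ y in 𝓝[≠] z, ¬ P y := hz2
  obtain ⟨w, hw1, hw2⟩ := (hz1.and hz2).exists
  exact hw2 hw1

namespace ZdAction1bv

variable {d : ℕ} (ρ : ZdAction1bv d)

/-- Points of `[0,1]` that are not globally fixed. -/
def M : Set ℝ := {x | x ∈ Icc (0:ℝ) 1 ∧ ∃ a, ρ.act a x ≠ x}

lemma M_Ioo {x : ℝ} (hx : x ∈ ρ.M) : x ∈ Ioo (0:ℝ) 1 := by
  obtain ⟨hx, a, ha⟩ := hx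
  refine ⟨lt_of_le_of_ne hx.1 ?_, lt_of_le_of_ne hx.2 ?_⟩
  · rintro rfl; exact ha (ρ.act_at_zero a)
  · rintro rfl; exact ha (ρ.act_at_one a)

lemma M_Icc {x : ℝ} (hx : x ∈ ρ.M) : x ∈ Icc (0:ℝ) 1 := hx.1

lemma fix_of_not_M {x : ℝ} (hx : x ∈ Icc (0:ℝ) 1) (h : x ∉ ρ.M) (a : Fin d → ℤ) :
    ρ.act a x = x := by
  by_contra hne
  exact h ⟨hx, a, hne⟩

lemma M_isOpen : IsOpen ρ.M := by
  rw [isOpen_iff_mem_nhds]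
  intro x hx
  have hx1 := ρ.M_Ioo hx
  obtain ⟨_, a, ha⟩ := hx
  have : ∀ᶠ y in 𝓝 x, ρ.act a y ≠ y := 
    ((isClosed_eq (ρ.act_continuous a) continuous_id).isOpen_compl).mem_nhds ha
  filter_upwards [this, Icc_mem_nhds hx1.1 hx1.2] with y hy1 hy2
  exact ⟨hy2, a, hy1⟩

lemma slope_tendsto (g : Fin d → ℤ) {p : ℝ} (hp : p ∈ Icc (0:ℝ) 1) (hfix : ρ.act g p = p) :
    Tendsto (fun y => (ρ.act g y - p) / (y - p)) (𝓝[Icc (0:ℝ) 1 \ {p}] p) (𝓝 (ρ.dd g p)) := by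
  have h := (hasDerivWithinAt_iff_tendsto_slope.1 (ρ.hasDeriv g hp))
  refine h.congr fun y => ?_
  rw [slope_def_field, hfix]

lemma dd_eq_one (g : Fin d → ℤ) {p : ℝ} (hp : p ∈ Icc (0:ℝ) 1) (hfix : ρ.act g p = p)
    (hfr : ∃ᶠ y in 𝓝[Icc (0:ℝ) 1 \ {p}] p, ρ.act g y = y) : ρ.dd g p = 1 := by
  refine tendsto_nhds_unique_of_frequently_eq (ρ.slope_tendsto g hp hfix)
    (tendsto_const_nhds (x := (1:ℝ))) ?_
  refine (hfr.and_eventually self_mem_nhdsWithin).mono ?_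
  rintro y ⟨hy, hyp⟩
  rw [hy]
  exact div_self (sub_ne_zero.2 hyp.2)

lemma mvt_lower (b : Fin d → ℤ) {y q c : ℝ} (hy : y ∈ Icc (0:ℝ) 1) (hq : q ∈ Icc (0:ℝ) 1)
    (hyq : y ≤ q) (hc : ∀ w ∈ Icc y q, c ≤ ρ.dd b w) :
    c * (q - y) ≤ ρ.act b q - ρ.act b y := by
  have hsub : Ioo y q ⊆ Ioo (0:ℝ) 1 := Ioo_subset_Ioo hy.1 hq.2
  refine (convex_Icc y q).mul_sub_le_image_sub_of_le_deriv (ρ.act_continuous b).continuousOn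
    ?_ ?_ y (left_mem_Icc.2 hyq) q (right_mem_Icc.2 hyq) hyq
  · intro w hw
    rw [interior_Icc] at hw
    exact (ρ.hasDerivAt' b (hsub hw)).differentiableAt.differentiableWithinAt
  · intro w hw
    rw [interior_Icc] at hw
    rw [(ρ.hasDerivAt' b (hsub hw)).deriv]
    exact hc w (Ioo_subset_Icc_self hw)

lemma mvt_lower' (b : Fin d → ℤ) {y q c : ℝ} (hy : y ∈ Icc (0:ℝ) 1) (hq : q ∈ Icc (0:ℝ) 1)
    (hc : ∀ w ∈ uIcc y q, c ≤ ρ.dd b w) :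
    c * |q - y| ≤ |ρ.act b q - ρ.act b y| := by
  rcases le_total y q with h | h
  · rw [uIcc_of_le h] at hc
    rw [abs_of_nonneg (by linarith : 0 ≤ q - y)]
    exact (ρ.mvt_lower b hy hq h hc).trans (le_abs_self _)
  · rw [uIcc_of_ge h] at hc
    rw [abs_sub_comm, abs_sub_comm (ρ.act b q), abs_of_nonneg (by linarith : 0 ≤ y - q)]
    exact (ρ.mvt_lower b hq hy h hc).trans (le_abs_self _)

/-- Kopell's lemma. -/
lemma kopell (g h : Fin d → ℤ) {x y : ℝ} (hx : x ∈ Icc (0:ℝ) 1) (hh : ρ.act h x ≠ x)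
    (hg : ρ.act g x = x) (hy : y ∈ uIcc x (ρ.act h x)) : ρ.act g y = y := by
  obtain ⟨p, hpI, hp, hfp⟩ := ρ.seq_lim h hx
  have hsub : uIcc x (ρ.act h x) ⊆ Icc (0:ℝ) 1 :=
    ordConnected_Icc.uIcc_subset hx (ρ.act_mem h hx)
  have hgn : ∀ n : ℕ, ρ.act g (ρ.act (n • h) x) = ρ.act (n • h) x := by
    intro n
    rw [act_comm, hg]
  have hgp : ρ.act g p = p := by
    have := ((ρ.act_continuous g).tendsto p).comp hp
    exact tendsto_nhds_unique this (hp.congr fun n => (hgn n).symm)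
  have hne : ∀ n : ℕ, ρ.act (n • h) x ≠ p := by
    intro n hn
    have h1 : ρ.act (n • h) (ρ.act h x) = ρ.act (n • h) x := by
      rw [act_comm, hn, hfp]
    exact hh ((ρ.act_strictMono _).injective h1)
  have hfix1 : ∀ (k : ℕ) (w : ℝ), ρ.act g w = w → ρ.act (k • g) w = w := by
    intro k w hw
    induction k with
    | zero => simp [act_zero]
    | succ k ih => rw [act_succ, ih, hw]
  have hp' : Tendsto (fun n : ℕ => ρ.act (n • h) x) atTop (𝓝[Icc (0:ℝ) 1 \ {p}] p) :=
    tendsto_nhdsWithin_iff.2 ⟨hp, Eventually.of_forall fun n => ⟨ρ.act_mem _ hx, hne n⟩⟩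
  have hllp : ∀ k : ℕ, ρ.ll (k • g) p = 0 := by
    intro k
    have : ρ.dd (k • g) p = 1 := by
      refine ρ.dd_eq_one _ hpI (hfix1 k p hgp) ?_
      refine hp'.frequently ?_
      exact (Eventually.of_forall fun n => hfix1 k _ (hgn n)).frequently
    rw [ll, this, Real.log_one]
  set V := (eVariationOn (ρ.ll h) (uIcc x p)).toReal
  have hpres : ∀ (k : ℕ) (w : ℝ), w ∈ uIcc x (ρ.act h x) → ρ.act (k • g) w ∈ uIcc x (ρ.act h x) := by
    intro k w hw
    have := ρ.act_uIcc (k • g) hw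
    rwa [hfix1 k x hg, hfix1 k (ρ.act h x) (by rw [act_comm, hg])] at this
  have hbd : ∀ (k : ℕ) (w : ℝ), w ∈ uIcc x (ρ.act h x) → Real.exp (-V) ≤ ρ.dd (k • g) w := by
    intro k w hw
    have := ρ.dist_est h (k • g) hx hw (hpres k w hw) hp
    rw [hllp, sub_zero] at this
    rw [← ρ.exp_ll _ (hsub hw), Real.exp_le_exp]
    exact (abs_le.1 this).1
  obtain ⟨q, hqI, hq, hfq⟩ := ρ.seq_lim g (hsub hy)
  have hqJ : q ∈ uIcc x (ρ.act h x) :=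
    isClosed_Icc.mem_of_tendsto hq (Eventually.of_forall fun n => hpres n y hy)
  have hineq : ∀ k : ℕ, Real.exp (-V) * |q - y| ≤ |q - ρ.act (k • g) y| := by
    intro k
    have := ρ.mvt_lower' (k • g) (hsub hy) hqI
      (fun w hw => hbd k w (uIcc_subset_uIcc hy hqJ hw))
    rwa [hfix1 k q hfq] at this
  have hlim : Tendsto (fun k : ℕ => |q - ρ.act (k • g) y|) atTop (𝓝 |q - q|) :=
    (tendsto_const_nhds.sub hq).abs
  have h0 := ge_of_tendsto' hlim hineq
  rw [sub_self, abs_zero] at h0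
  have h1 : |q - y| ≤ 0 := by
    by_contra hc
    push Not at hc
    have := mul_pos (Real.exp_pos (-V)) hc
    linarith
  have h2 : q = y := by
    have := abs_nonpos_iff.1 h1
    linarith
  rw [← h2, hfq]

lemma act_neg_gt {a : Fin d → ℤ} {x : ℝ} (h : ρ.act a x < x) : x < ρ.act (-a) x := by
  have := ρ.act_strictMono (-a) h
  rwa [act_neg_act] at this

lemma act_neg_lt {a : Fin d → ℤ} {x : ℝ} (h : x < ρ.act a x) : ρ.act (-a) x < x := by
  have := ρ.act_strictMono (-a) h
  rwa [act_neg_act] at this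

lemma kopell_nhds (g : Fin d → ℤ) {x : ℝ} (hx : x ∈ ρ.M) (hg : ρ.act g x = x) :
    ∀ᶠ y in 𝓝 x, ρ.act g y = y := by
  have hxI := ρ.M_Icc hx
  have key : ∀ h, x < ρ.act h x → ∀ᶠ y in 𝓝 x, ρ.act g y = y := by
    intro h hh
    have hn := ρ.act_neg_lt hh
    filter_upwards [Ioo_mem_nhds hn hh] with y hy
    rcases le_total x y with hxy | hxy
    · exact ρ.kopell g h hxI hh.ne' hg (by rw [uIcc_of_le hh.le]; exact ⟨hxy, hy.2.le⟩)
    · exact ρ.kopell g (-h) hxI hn.ne hg (by rw [uIcc_of_ge hn.le]; exact ⟨hy.1.le, hxy⟩)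
  obtain ⟨_, h, hh⟩ := hx
  rcases lt_or_gt_of_ne hh with hh | hh
  · exact key (-h) (ρ.act_neg_gt hh)
  · exact key h hh

lemma conn_fix (g : Fin d → ℤ) {J : Set ℝ} (hJ : IsPreconnected J) (hJM : J ⊆ ρ.M) {x : ℝ}
    (hx : x ∈ J) (hg : ρ.act g x = x) : ∀ y ∈ J, ρ.act g y = y := by
  set u : Set ℝ := {y | y ∈ ρ.M ∧ ρ.act g y = y}
  have hu : IsOpen u := by
    rw [isOpen_iff_mem_nhds]
    rintro y ⟨hyM, hy⟩
    filter_upwards [ρ.M_isOpen.mem_nhds hyM, ρ.kopell_nhds g hyM hy] with z h1 h2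
    exact ⟨h1, h2⟩
  have hcl : IsClosed {y | ρ.act g y = y} := isClosed_eq (ρ.act_continuous g) continuous_id
  have : J ⊆ u := by
    refine hJ.subset_of_closure_inter_subset hu ⟨x, hx, hJM hx, hg⟩ ?_
    rintro y ⟨hy1, hy2⟩
    refine ⟨hJM hy2, ?_⟩
    exact closure_minimal (fun z hz => hz.2) hcl hy1
  exact fun y hy => (this hy).2

lemma side_arch {p e : ℝ} (hp : p ∈ Icc (0:ℝ) 1) (hpM : p ∉ ρ.M) (he : e ≠ 0)
    (hJ : ∀ r ∈ Ioo (0:ℝ) 1, p + r * e ∈ ρ.M) (g : Fin d → ℤ)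
    (hg : ρ.act g (p + (1/2) * e) ≠ p + (1/2) * e) (hd : ρ.ll g p = 0) :
    ∀ h, ρ.ll h p = 0 := by
  have hfix := ρ.fix_of_not_M hp hpM
  set δ : (Fin d → ℤ) →+ ℝ := AddMonoidHom.mk' (fun a => ρ.ll a p) (by
    intro a b
    rw [ρ.ll_add a b hp, hfix b]) with hδ
  have hback : ∀ (a : Fin d → ℤ) (r : ℝ),
      p + ((ρ.act a (p + r * e) - p) / e) * e = ρ.act a (p + r * e) := by
    intro a r
    field_simp
    ring
  have hfixiff : ∀ (a : Fin d → ℤ) (r : ℝ),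
      (ρ.act a (p + r * e) - p) / e = r ↔ ρ.act a (p + r * e) = p + r * e := by
    intro a r
    rw [div_eq_iff he, sub_eq_iff_eq_add']
  have hJc : IsPreconnected ((fun r : ℝ => p + r * e) '' Ioo (0:ℝ) 1) :=
    isPreconnected_Ioo.image _ (by fun_prop)
  refine arch_core (fun a r => (ρ.act a (p + r * e) - p) / e) δ ?_ ?_ ?_ ?_ ?_ ?_ ?_ g ?_ hd
  · intro a b r
    rw [hback, act_add]
  · intro r
    rw [hfixiff, act_zero]
  · intro a r s hrs
    rcases lt_or_gt_of_ne he with he | he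
    · apply div_lt_div_of_neg_of_lt he
      have : p + s * e < p + r * e := by nlinarith
      linarith [ρ.act_strictMono a this]
    · apply div_lt_div_of_pos_right _ he
      have : p + r * e < p + s * e := by nlinarith
      linarith [ρ.act_strictMono a this]
  · intro a
    have := ρ.act_continuous a
    fun_prop
  · intro a
    simp [hfix a]
  · intro a
    have h1 := ρ.slope_tendsto a hp (hfix a)
    have e1 : Real.exp (δ a) = ρ.dd a p := ρ.exp_ll a hp
    rw [e1]
    have h2 : Tendsto (fun r : ℝ => p + r * e) (𝓝[>] 0) (𝓝[Icc (0:ℝ) 1 \ {p}] p) := by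
      refine tendsto_nhdsWithin_iff.2 ⟨?_, ?_⟩
      · have : Continuous fun r : ℝ => p + r * e := by fun_prop
        have := this.tendsto 0
        simp only [zero_mul, add_zero] at this
        exact this.mono_left nhdsWithin_le_nhds
      · filter_upwards [Ioo_mem_nhdsGT (zero_lt_one' ℝ)] with r hr
        refine ⟨ρ.M_Icc (hJ r hr), ?_⟩
        simp [he, hr.1.ne']
    refine (h1.comp h2).congr fun r => ?_
    simp only [Function.comp]
    rw [add_sub_cancel_left, div_div, mul_comm]
  · intro a r hr hra s hs
    rw [hfixiff] at hra ⊢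
    exact ρ.conn_fix a hJc (by rintro _ ⟨t, ht, rfl⟩; exact hJ t ht) ⟨r, hr, rfl⟩ hra _ ⟨s, hs, rfl⟩
  · intro h
    exact hg ((hfixiff g _).1 h)

end ZdAction1bv

namespace ZdAction1bv

variable {d : ℕ} (ρ : ZdAction1bv d)

/-- No parabolic global fixed point in the interior. -/
def NoPar : Prop := ∀ p ∈ Ioo (0:ℝ) 1, p ∉ ρ.M → ∃ h, ρ.ll h p ≠ 0

lemma dd_ne_one (g : Fin d → ℤ) {p : ℝ} (h : ρ.ll g p ≠ 0) : ρ.dd g p ≠ 1 := by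
  intro h1
  exact h (by rw [ll, h1, Real.log_one])

lemma eventually_moved (g : Fin d → ℤ) {p : ℝ} (hp : p ∈ Ioo (0:ℝ) 1) (h : ρ.ll g p ≠ 0) :
    ∀ᶠ y in 𝓝[≠] p, ρ.act g y ≠ y := by
  have h1 : HasDerivAt (fun y => ρ.act g y - y) (ρ.dd g p - 1) p :=
    (ρ.hasDerivAt' g hp).sub (hasDerivAt_id p)
  filter_upwards [h1.eventually_ne (c := 0) (sub_ne_zero.2 (ρ.dd_ne_one g h))] with y hy
  exact sub_ne_zero.1 hy

lemma isolated (hnp : ρ.NoPar) {p : ℝ} (hp : p ∈ Ioo (0:ℝ) 1) (hpM : p ∉ ρ.M) :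
    ∀ᶠ y in 𝓝[≠] p, y ∈ ρ.M := by
  obtain ⟨h, hh⟩ := hnp p hp hpM
  filter_upwards [ρ.eventually_moved h hp hh,
    mem_nhdsWithin_of_mem_nhds (Icc_mem_nhds hp.1 hp.2)] with y hy1 hy2
  exact ⟨hy2, h, hy1⟩

lemma eventually_fixed (hnp : ρ.NoPar) (g : Fin d → ℤ) {p : ℝ} (hp : p ∈ Ioo (0:ℝ) 1)
    (hpM : p ∉ ρ.M) (h : ρ.ll g p = 0) : ∀ᶠ y in 𝓝[≠] p, ρ.act g y = y := by
  have hpI := Ioo_subset_Icc_self hp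
  obtain ⟨k, hk⟩ := hnp p hp hpM
  have hiso := ρ.isolated hnp hp hpM
  obtain ⟨ε, hε, hball⟩ := Metric.mem_nhdsWithin_iff.1 hiso
  have hside : ∀ e, |e| = ε → ∀ r ∈ Ioo (0:ℝ) 1, ρ.act g (p + r * e) = p + r * e := by
    intro e he
    have he0 : e ≠ 0 := by
      rintro rfl
      simp at he
      exact hε.ne he
    have hJ : ∀ r ∈ Ioo (0:ℝ) 1, p + r * e ∈ ρ.M := by
      intro r hr
      refine hball ⟨?_, ?_⟩
      · rw [Metric.mem_ball, Real.dist_eq, add_sub_cancel_left, abs_mul, he, abs_of_pos hr.1]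
        nlinarith [hr.2]
      · simp [he0, hr.1.ne']
    have h12 : ρ.act g (p + (1/2) * e) = p + (1/2) * e := by
      by_contra hne
      exact hk (ρ.side_arch hpI hpM he0 hJ g hne h k)
    have hJc : IsPreconnected ((fun r : ℝ => p + r * e) '' Ioo (0:ℝ) 1) :=
      isPreconnected_Ioo.image _ (by fun_prop)
    intro r hr
    exact ρ.conn_fix g hJc (by rintro _ ⟨t, ht, rfl⟩; exact hJ t ht)
      ⟨1/2, by constructor <;> norm_num, rfl⟩ h12 _ ⟨r, hr, rfl⟩
  refine Metric.mem_nhdsWithin_iff.2 ⟨ε, hε, ?_⟩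
  rintro y ⟨hy1, hy2⟩
  rw [Metric.mem_ball, Real.dist_eq] at hy1
  have hy2 : y ≠ p := hy2
  have hpos : 0 < |y - p| := abs_pos.2 (sub_ne_zero.2 hy2)
  have hr : |y - p| / ε ∈ Ioo (0:ℝ) 1 := ⟨div_pos hpos hε, (div_lt_one hε).2 hy1⟩
  show ρ.act g y = y
  rcases lt_or_gt_of_ne hy2 with hlt | hgt
  · have := hside (-ε) (by rw [abs_neg, abs_of_pos hε]) _ hr
    have e1 : p + |y - p| / ε * -ε = y := by
      rw [abs_of_neg (by linarith)]
      field_simp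
      ring
    rwa [e1] at this
  · have := hside ε (abs_of_pos hε) _ hr
    have e1 : p + |y - p| / ε * ε = y := by
      rw [abs_of_pos (by linarith)]
      field_simp
      ring
    rwa [e1] at this

lemma trivial_or_free (hnp : ρ.NoPar) (g : Fin d → ℤ) :
    (∀ x, ρ.act g x = x) ∨ (∀ x ∈ ρ.M, ρ.act g x ≠ x) := by
  have hcl : IsClosed {y | ρ.act g y = y} := isClosed_eq (ρ.act_continuous g) continuous_id
  rcases punctured_conn (fun y => ρ.act g y = y) (by
    intro x hx
    by_cases hxM : x ∈ ρ.M
    · by_cases hg : ρ.act g x = x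
      · exact Or.inl (eventually_nhdsWithin_of_eventually_nhds (ρ.kopell_nhds g hxM hg))
      · exact Or.inr (eventually_nhdsWithin_of_eventually_nhds (hcl.isOpen_compl.mem_nhds hg))
    · by_cases hg : ρ.ll g x = 0
      · exact Or.inl (ρ.eventually_fixed hnp g hx hxM hg)
      · exact Or.inr (ρ.eventually_moved g hx hg)) with h | h
  · left
    intro x
    by_cases hx : x ∈ Ioo (0:ℝ) 1
    · have h1 := h x hx
      have h2 : x ∈ closure {y | ρ.act g y = y} :=
        mem_closure_iff_frequently.2 (h1.frequently.filter_mono nhdsWithin_le_nhds)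
      rwa [hcl.closure_eq] at h2
    · by_cases hxI : x ∈ Icc (0:ℝ) 1
      · exact ρ.fix_of_not_M hxI (fun hM => hx (ρ.M_Ioo hM)) g
      · exact ρ.act_outside g hxI
  · right
    intro x hx hfix
    have h1 : ∀ᶠ y in 𝓝[≠] x, ρ.act g y = y :=
      eventually_nhdsWithin_of_eventually_nhds (ρ.kopell_nhds g hx hfix)
    obtain ⟨y, hy1, hy2⟩ := (h1.and (h x (ρ.M_Ioo hx))).exists
    exact hy2 hy1

lemma M_dense (hnp : ρ.NoPar) {x : ℝ} (hx : x ∈ Ioo (0:ℝ) 1) : x ∈ closure ρ.M := by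
  by_cases hxM : x ∈ ρ.M
  · exact subset_closure hxM
  · exact mem_closure_iff_frequently.2
      ((ρ.isolated hnp hx hxM).frequently.filter_mono nhdsWithin_le_nhds)

lemma slope_sub_tendsto (g : Fin d → ℤ) {p : ℝ} (hp : p ∈ Icc (0:ℝ) 1) (hfix : ρ.act g p = p) :
    Tendsto (fun y => (ρ.act g y - y) / (y - p)) (𝓝[Icc (0:ℝ) 1 \ {p}] p)
      (𝓝 (ρ.dd g p - 1)) := by
  refine ((ρ.slope_tendsto g hp hfix).sub_const 1).congr' ?_
  filter_upwards [self_mem_nhdsWithin] with y hy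
  have : y - p ≠ 0 := sub_ne_zero.2 hy.2
  field_simp
  ring

lemma sign_const (hnp : ρ.NoPar) (f g : Fin d → ℤ) (hf : ∀ x ∈ ρ.M, ρ.act f x ≠ x)
    (hg : ∀ x ∈ ρ.M, ρ.act g x ≠ x) :
    (∀ x ∈ ρ.M, 0 < (ρ.act g x - x) * (ρ.act f x - x)) ∨
    (∀ x ∈ ρ.M, (ρ.act g x - x) * (ρ.act f x - x) < 0) := by
  have hcont : Continuous fun x => (ρ.act g x - x) * (ρ.act f x - x) :=
    ((ρ.act_continuous g).sub continuous_id).mul ((ρ.act_continuous f).sub continuous_id)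
  have hne : ∀ x ∈ ρ.M, (ρ.act g x - x) * (ρ.act f x - x) ≠ 0 := fun x hx =>
    mul_ne_zero (sub_ne_zero.2 (hg x hx)) (sub_ne_zero.2 (hf x hx))
  have hll : ∀ k : Fin d → ℤ, (∀ x ∈ ρ.M, ρ.act k x ≠ x) → ∀ p ∈ Ioo (0:ℝ) 1, p ∉ ρ.M →
      ρ.dd k p - 1 ≠ 0 := by
    intro k hk p hp hpM
    apply sub_ne_zero.2
    apply ρ.dd_ne_one
    intro h0
    obtain ⟨y, hy1, hy2⟩ :=
      ((ρ.eventually_fixed hnp k hp hpM h0).and (ρ.isolated hnp hp hpM)).exists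
    exact hk y hy2 hy1
  rcases punctured_conn (fun x => 0 < (ρ.act g x - x) * (ρ.act f x - x)) (by
    intro x hx
    by_cases hxM : x ∈ ρ.M
    · rcases lt_or_gt_of_ne (hne x hxM) with h | h
      · right
        apply eventually_nhdsWithin_of_eventually_nhds
        filter_upwards [hcont.continuousAt.eventually (gt_mem_nhds h)] with y hy
        exact not_lt.2 hy.le
      · left
        apply eventually_nhdsWithin_of_eventually_nhds
        exact hcont.continuousAt.eventually (lt_mem_nhds h)
    · have hxI := Ioo_subset_Icc_self hx
      have h1 := (ρ.slope_sub_tendsto g hxI (ρ.fix_of_not_M hxI hxM g)).mul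
        (ρ.slope_sub_tendsto f hxI (ρ.fix_of_not_M hxI hxM f))
      have hfil : 𝓝[Icc (0:ℝ) 1 \ {x}] x = 𝓝[≠] x := by
        rw [diff_eq, nhdsWithin_inter_of_mem]
        exact mem_nhdsWithin_of_mem_nhds (Icc_mem_nhds hx.1 hx.2)
      rw [hfil] at h1
      have heq : ∀ y, y ≠ x → ((ρ.act g y - y) / (y - x) * ((ρ.act f y - y) / (y - x)))
          = ((ρ.act g y - y) * (ρ.act f y - y)) / ((y - x)^2) := by
        intro y hy
        have : y - x ≠ 0 := sub_ne_zero.2 hy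
        field_simp
      rcases lt_or_gt_of_ne (mul_ne_zero (hll g hg x hx hxM) (hll f hf x hx hxM)) with h | h
      · right
        filter_upwards [h1.eventually (gt_mem_nhds h), self_mem_nhdsWithin] with y hy1 hy2
        rw [heq y hy2] at hy1
        intro hcon
        have := div_nonneg hcon.le (sq_nonneg (y - x))
        linarith
      · left
        filter_upwards [h1.eventually (lt_mem_nhds h), self_mem_nhdsWithin] with y hy1 hy2
        rw [heq y hy2] at hy1
        have hp : 0 < (y - x)^2 := by
          have : y - x ≠ 0 := sub_ne_zero.2 hy2
          positivity
        exact (div_pos_iff_of_pos_right hp).1 hy1) with h | h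
  · left
    intro x hx
    by_contra hcon
    have hlt := lt_of_le_of_ne (not_lt.1 hcon) (hne x hx)
    have h1 : ∀ᶠ y in 𝓝[≠] x, (ρ.act g y - y) * (ρ.act f y - y) < 0 :=
      eventually_nhdsWithin_of_eventually_nhds (hcont.continuousAt.eventually (gt_mem_nhds hlt))
    obtain ⟨y, hy1, hy2⟩ := (h1.and (h x (ρ.M_Ioo hx))).exists
    exact lt_asymm hy1 hy2
  · right
    intro x hx
    by_contra hcon
    have hlt := lt_of_le_of_ne (not_lt.1 hcon) (hne x hx).symm
    have h1 : ∀ᶠ y in 𝓝[≠] x, 0 < (ρ.act g y - y) * (ρ.act f y - y) :=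
      eventually_nhdsWithin_of_eventually_nhds (hcont.continuousAt.eventually (lt_mem_nhds hlt))
    obtain ⟨y, hy1, hy2⟩ := (h1.and (h x (ρ.M_Ioo hx))).exists
    exact hy2 hy1

/-- `a` moves points in the same direction as `f`. -/
def Cone (f a : Fin d → ℤ) : Prop :=
  ∀ x, (x < ρ.act f x → x ≤ ρ.act a x) ∧ (ρ.act f x < x → ρ.act a x ≤ x)

lemma mem_M_of_moved {f : Fin d → ℤ} {x : ℝ} (h : ρ.act f x ≠ x) : x ∈ ρ.M := by
  by_cases hx : x ∈ Icc (0:ℝ) 1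
  · exact ⟨hx, f, h⟩
  · exact (h (ρ.act_outside f hx)).elim

lemma cone_of_trivial (f : Fin d → ℤ) {a : Fin d → ℤ} (h : ∀ x, ρ.act a x = x) :
    ρ.Cone f a := fun x => ⟨fun _ => (h x).ge, fun _ => (h x).le⟩

lemma cone_add {f a b : Fin d → ℤ} (ha : ρ.Cone f a) (hb : ρ.Cone f b) : ρ.Cone f (a + b) := by
  intro x
  rw [act_add]
  exact ⟨fun h => ((ha x).1 h).trans ((ρ.act_strictMono a).monotone ((hb x).1 h)),
    fun h => ((ρ.act_strictMono a).monotone ((hb x).2 h)).trans ((ha x).2 h)⟩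

lemma cone_total (hnp : ρ.NoPar) {f : Fin d → ℤ} (hf : ∀ x ∈ ρ.M, ρ.act f x ≠ x)
    (a : Fin d → ℤ) : ρ.Cone f a ∨ ρ.Cone f (-a) := by
  rcases ρ.trivial_or_free hnp a with h | h
  · exact Or.inl (ρ.cone_of_trivial f h)
  · rcases ρ.sign_const hnp f a hf h with h | h
    · left
      intro x
      refine ⟨fun hx => ?_, fun hx => ?_⟩
      · have := h x (ρ.mem_M_of_moved hx.ne')
        have h2 := (pos_iff_pos_of_mul_pos this).2 (by linarith)
        linarith
      · have := h x (ρ.mem_M_of_moved hx.ne)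
        have h2 := (neg_iff_neg_of_mul_pos this).2 (by linarith)
        linarith
    · right
      intro x
      refine ⟨fun hx => ?_, fun hx => ?_⟩
      · have := h x (ρ.mem_M_of_moved hx.ne')
        have h2 : ρ.act a x < x := by nlinarith
        exact (ρ.act_neg_gt h2).le
      · have := h x (ρ.mem_M_of_moved hx.ne)
        have h2 : x < ρ.act a x := by nlinarith
        exact (ρ.act_neg_lt h2).le

lemma cone_antisymm (hnp : ρ.NoPar) {f : Fin d → ℤ} {x₀ : ℝ} (hx₀ : ρ.act f x₀ ≠ x₀)
    {a : Fin d → ℤ} (h1 : ρ.Cone f a) (h2 : ρ.Cone f (-a)) : ∀ x, ρ.act a x = x := by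
  refine (ρ.trivial_or_free hnp a).resolve_right fun hcon => ?_
  have hM := ρ.mem_M_of_moved hx₀
  rcases lt_or_gt_of_ne hx₀ with h | h
  · have e1 := (h1 x₀).2 h
    have e2 := (h2 x₀).2 h
    exact absurd (ρ.act_neg_gt (lt_of_le_of_ne e1 (hcon x₀ hM))) (not_lt.2 e2)
  · have e1 := (h1 x₀).1 h
    have e2 := (h2 x₀).1 h
    exact absurd (ρ.act_neg_lt (lt_of_le_of_ne e1 (hcon x₀ hM).symm)) (not_lt.2 e2)

lemma seq_lim_not_M {f : Fin d → ℤ} (hf : ∀ x ∈ ρ.M, ρ.act f x ≠ x) {x : ℝ}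
    (hx : x ∈ Icc (0:ℝ) 1) :
    ∃ p ∈ Icc (0:ℝ) 1, Tendsto (fun n : ℕ => ρ.act (n • f) x) atTop (𝓝 p) ∧ p ∉ ρ.M := by
  obtain ⟨p, hp, hlim, hfix⟩ := ρ.seq_lim f hx
  exact ⟨p, hp, hlim, fun h => hf p h hfix⟩

lemma cone_arch (hnp : ρ.NoPar) {f : Fin d → ℤ} (hf : ∀ x ∈ ρ.M, ρ.act f x ≠ x)
    {x₀ : ℝ} (hx₀ : x₀ ∈ ρ.M) (a : Fin d → ℤ) {b : Fin d → ℤ}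
    (hb : ρ.Cone f b) (hb' : ¬ ∀ x, ρ.act b x = x) : ∃ n : ℕ, ρ.Cone f (n • b - a) := by
  have hbf := (ρ.trivial_or_free hnp b).resolve_left hb'
  obtain ⟨p, hpI, hp, hpM⟩ := ρ.seq_lim_not_M hbf (ρ.M_Icc hx₀)
  have hap := ρ.fix_of_not_M hpI hpM a
  have hne : ρ.act a x₀ ≠ p := by
    intro h
    have : x₀ = p := (ρ.act_strictMono a).injective (h.trans hap.symm)
    exact hpM (this ▸ hx₀)
  by_contra hcon
  push Not at hcon
  have hneg : ∀ n : ℕ, ρ.Cone f (a - n • b) := by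
    intro n
    have := (ρ.cone_total hnp hf (n • b - a)).resolve_left (hcon n)
    rwa [neg_sub] at this
  have hcomp : ∀ n : ℕ, ρ.act (n • b) (ρ.act (a - n • b) x₀) = ρ.act a x₀ := by
    intro n
    rw [← act_add]
    congr 1
    abel
  rcases lt_or_gt_of_ne (hf x₀ hx₀) with h | h
  · have hmon := ρ.seq_anti b ((hb x₀).2 h)
    have h1 : ρ.act a x₀ ≤ p := ge_of_tendsto' hp fun n => by
      have := (ρ.act_strictMono (n • b)).monotone ((hneg n x₀).2 h)
      rwa [hcomp] at this
    have h2 : p ≤ x₀ := by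
      have := hmon.le_of_tendsto hp 0
      simpa [ρ.act_zero] using this
    have h3 := (ρ.act_strictMono a).monotone h2
    rw [hap] at h3
    exact hne (le_antisymm h1 h3)
  · have hmon := ρ.seq_mono b ((hb x₀).1 h)
    have h1 : p ≤ ρ.act a x₀ := le_of_tendsto' hp fun n => by
      have := (ρ.act_strictMono (n • b)).monotone ((hneg n x₀).1 h)
      rwa [hcomp] at this
    have h2 : x₀ ≤ p := by
      have := hmon.ge_of_tendsto hp 0
      simpa [ρ.act_zero] using this
    have h3 := (ρ.act_strictMono a).monotone h2
    rw [hap] at h3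
    exact hne (le_antisymm h3 h1)


end ZdAction1bv

lemma exists_hom_real {A : Type*} [AddCommGroup A] (C : A → Prop) (K : AddSubgroup A)
    (hK : ∀ a, C a → C (-a) → a ∈ K) (hK' : ∀ a ∈ K, C a)
    (hadd : ∀ a b, C a → C b → C (a + b)) (htot : ∀ a, C a ∨ C (-a))
    (harch : ∀ a b, C b → b ∉ K → ∃ n : ℕ, C (n • b - a)) :
    ∃ τ : A →+ ℝ, (∀ a, 0 ≤ τ a ↔ C a) ∧ ∀ a, τ a = 0 → a ∈ K := by
  classical
  let P : AddGroupCone (A ⧸ K) :=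
    { carrier := {q | ∃ a, C a ∧ (QuotientAddGroup.mk a : A ⧸ K) = q}
      zero_mem' := ⟨0, hK' 0 K.zero_mem, rfl⟩
      add_mem' := by
        rintro _ _ ⟨a, ha, rfl⟩ ⟨b, hb, rfl⟩
        exact ⟨a + b, hadd a b ha hb, rfl⟩
      eq_zero_of_mem_of_neg_mem' := by
        rintro _ ⟨a, ha, rfl⟩ ⟨b, hb, hab⟩
        rw [QuotientAddGroup.eq_zero_iff]
        apply hK a ha
        have h1 : -b + -a ∈ K := by
          have h2 : (QuotientAddGroup.mk b : A ⧸ K) = QuotientAddGroup.mk (-a) := hab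
          exact QuotientAddGroup.eq.1 h2
        have := hadd _ _ hb (hK' _ h1)
        simpa using this }
  have hmem : ∀ a, (QuotientAddGroup.mk a : A ⧸ K) ∈ P ↔ C a := by
    intro a
    constructor
    · rintro ⟨b, hb, hab⟩
      have h1 : -b + a ∈ K := QuotientAddGroup.eq.1 hab
      have := hadd _ _ hb (hK' _ h1)
      simpa using this
    · intro h
      exact ⟨a, h, rfl⟩
  haveI : HasMemOrNegMem P := ⟨by
    intro q
    induction q using QuotientAddGroup.induction_on with
    | H a => exact (htot a).imp (hmem a).2 (hmem (-a)).2⟩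
  letI : LinearOrder (A ⧸ K) := LinearOrder.mkOfAddGroupCone P
  haveI : IsOrderedAddMonoid (A ⧸ K) := IsOrderedAddMonoid.mkOfCone P
  have hle : ∀ a b : A, (QuotientAddGroup.mk a : A ⧸ K) ≤ QuotientAddGroup.mk b ↔ C (b - a) := by
    intro a b
    exact hmem (b - a)
  have h0 : ∀ a, (0 : A ⧸ K) ≤ QuotientAddGroup.mk a ↔ C a := by
    intro a
    have := hle 0 a
    rwa [sub_zero] at this
  haveI : Archimedean (A ⧸ K) := ⟨by
    intro x y hy
    induction x using QuotientAddGroup.induction_on with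
    | H a =>
      induction y using QuotientAddGroup.induction_on with
      | H b =>
        have hb : C b := (h0 b).1 hy.le
        have hbK : b ∉ K := fun h => hy.ne' ((QuotientAddGroup.eq_zero_iff b).2 h)
        obtain ⟨n, hn⟩ := harch a b hb hbK
        exact ⟨n, (hle a (n • b)).2 hn⟩⟩
  obtain ⟨e, he⟩ := Archimedean.exists_orderAddMonoidHom_real_injective (A ⧸ K)
  have hmono : StrictMono e := e.monotone'.strictMono_of_injective he
  refine ⟨(e : (A ⧸ K) →+ ℝ).comp (QuotientAddGroup.mk' K), fun a => ?_, fun a ha => ?_⟩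
  · rw [← h0 a, ← hmono.le_iff_le, map_zero]
    rfl
  · have h1 : e (QuotientAddGroup.mk a : A ⧸ K) = e 0 := by
      rw [map_zero]
      exact ha
    exact (QuotientAddGroup.eq_zero_iff a).1 (he h1)

namespace ZdAction1bv

variable {d : ℕ} (ρ : ZdAction1bv d)

/-- The kernel of the action. -/
def ker : AddSubgroup (Fin d → ℤ) where
  carrier := {a | ∀ x, ρ.act a x = x}
  zero_mem' := ρ.act_zero
  add_mem' := by
    intro a b ha hb x
    rw [ρ.act_add, hb, ha]
  neg_mem' := by
    intro a ha x
    conv_lhs => rw [← ha x]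
    rw [ρ.act_neg_act]

/-- The data of a translation number `τ` adapted to `f`. -/
structure Tau (f : Fin d → ℤ) (τ : (Fin d → ℤ) →+ ℝ) : Prop where
  np : ρ.NoPar
  free : ∀ x ∈ ρ.M, ρ.act f x ≠ x
  one : τ f = 1
  cone : ∀ a, 0 ≤ τ a ↔ ρ.Cone f a
  triv : ∀ a, τ a = 0 → ∀ x, ρ.act a x = x

lemma exists_tau (hnp : ρ.NoPar) {f : Fin d → ℤ} (hf : ∀ x ∈ ρ.M, ρ.act f x ≠ x) {x₀ : ℝ}
    (hx₀ : x₀ ∈ ρ.M) : ∃ τ, ρ.Tau f τ := by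
  obtain ⟨τ, h1, h2⟩ := exists_hom_real (ρ.Cone f) ρ.ker
    (fun a => ρ.cone_antisymm hnp (hf x₀ hx₀)) (fun a ha => ρ.cone_of_trivial f ha)
    (fun a b => ρ.cone_add) (ρ.cone_total hnp hf)
    (fun a b hb hb' => ρ.cone_arch hnp hf hx₀ a hb hb')
  have hff : ρ.Cone f f := fun x => ⟨fun h => h.le, fun h => h.le⟩
  have hpos : 0 < τ f := lt_of_le_of_ne ((h1 f).2 hff) fun h => hf x₀ hx₀ (h2 f h.symm x₀)
  refine ⟨(AddMonoidHom.mulLeft (τ f)⁻¹).comp τ, hnp, hf, ?_, fun a => ?_, fun a ha => ?_⟩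
  · simp [hpos.ne']
  · rw [← h1 a]
    simp only [AddMonoidHom.coe_comp, AddMonoidHom.coe_mulLeft, Function.comp_apply]
    rw [mul_nonneg_iff_of_pos_left (inv_pos.2 hpos)]
  · apply h2 a
    simpa [hpos.ne'] using ha

lemma tau_dense {f : Fin d → ℤ} {τ : (Fin d → ℤ) →+ ℝ} (T : ρ.Tau f τ)
    (hnc : ¬ ∃ c : Fin d → ℤ, ∀ a : Fin d → ℤ, ∃ n : ℤ, ∀ x : ℝ, ρ.act a x = ρ.act (n • c) x) :
    DenseRange τ := by
  rcases τ.range.dense_or_cyclic with h | ⟨c, hc⟩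
  · rwa [AddMonoidHom.coe_range] at h
  · exfalso
    apply hnc
    have : c ∈ τ.range := hc ▸ AddSubgroup.subset_closure (mem_singleton c)
    obtain ⟨c', rfl⟩ := this
    refine ⟨c', fun a => ?_⟩
    have ha : τ a ∈ AddSubgroup.closure {τ c'} := hc ▸ ⟨a, rfl⟩
    obtain ⟨n, hn⟩ := AddSubgroup.mem_closure_singleton.1 ha
    refine ⟨n, fun x => ?_⟩
    have h0 := T.triv (a - n • c') (by rw [map_sub, map_zsmul, hn, sub_self])
    have := h0 (ρ.act (n • c') x)
    rwa [← ρ.act_add, sub_add_cancel] at this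

end ZdAction1bv

lemma log_mul_nonneg {x y : ℝ} (hx : 0 < x) (hy : 0 < y) (h : 0 ≤ (x - 1) * (y - 1)) :
    0 ≤ Real.log x * Real.log y := by
  rcases lt_trichotomy x 1 with h1 | h1 | h1
  · have h2 : y ≤ 1 := by nlinarith
    exact mul_nonneg_of_nonpos_of_nonpos (Real.log_nonpos hx.le h1.le) (Real.log_nonpos hy.le h2)
  · simp [h1]
  · have h2 : 1 ≤ y := by nlinarith
    exact mul_nonneg (Real.log_nonneg h1.le) (Real.log_nonneg h2)

namespace ZdAction1bv

variable {d : ℕ} (ρ : ZdAction1bv d)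

lemma ll_add_fix (a b : Fin d → ℤ) {p : ℝ} (hp : p ∈ Icc (0:ℝ) 1) (hpM : p ∉ ρ.M) :
    ρ.ll (a + b) p = ρ.ll a p + ρ.ll b p := by
  rw [ρ.ll_add a b hp, ρ.fix_of_not_M hp hpM]

lemma ll_nsmul_fix (a : Fin d → ℤ) (n : ℕ) {p : ℝ} (hp : p ∈ Icc (0:ℝ) 1) (hpM : p ∉ ρ.M) :
    ρ.ll (n • a) p = n * ρ.ll a p := by
  rw [ρ.ll_nsmul a n hp]
  simp [ρ.fix_of_not_M hp hpM]

lemma chi_sign {f : Fin d → ℤ} (hf : ∀ x ∈ ρ.M, ρ.act f x ≠ x) {a b : Fin d → ℤ}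
    (ha : ρ.Cone f a) (hb : ρ.Cone f b) {p : ℝ} (hp : p ∈ Icc (0:ℝ) 1) (hpM : p ∉ ρ.M) :
    0 ≤ ρ.ll a p * ρ.ll b p := by
  apply log_mul_nonneg (ρ.dd_pos a hp) (ρ.dd_pos b hp)
  have h1 := (ρ.slope_sub_tendsto a hp (ρ.fix_of_not_M hp hpM a)).mul
    (ρ.slope_sub_tendsto b hp (ρ.fix_of_not_M hp hpM b))
  have hne : (𝓝[Icc (0:ℝ) 1 \ {p}] p).NeBot := by
    have := uniqueDiffWithinAt_iff_accPt.1 (uniqueDiffOn_Icc (zero_lt_one' ℝ) p hp)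
    rw [accPt_principal_iff_nhdsWithin] at this
    exact this
  refine ge_of_tendsto h1 ?_
  filter_upwards [self_mem_nhdsWithin] with x hx
  rw [div_mul_div_comm]
  refine div_nonneg ?_ (mul_self_nonneg _)
  rcases lt_trichotomy x (ρ.act f x) with h | h | h
  · exact mul_nonneg (sub_nonneg.2 ((ha x).1 h)) (sub_nonneg.2 ((hb x).1 h))
  · have hxM : x ∉ ρ.M := fun h' => hf x h' h.symm
    rw [ρ.fix_of_not_M hx.1 hxM a]
    simp
  · exact mul_nonneg_of_nonpos_of_nonpos (sub_nonpos.2 ((ha x).2 h)) (sub_nonpos.2 ((hb x).2 h))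

variable {ρ} {f : Fin d → ℤ} {τ : (Fin d → ℤ) →+ ℝ}

lemma Tau.cone_of_nonneg (T : ρ.Tau f τ) {a : Fin d → ℤ} (h : 0 ≤ τ a) : ρ.Cone f a :=
  (T.cone a).1 h

lemma Tau.chi_bound (T : ρ.Tau f τ) {a : Fin d → ℤ} (h0 : 0 ≤ τ a) (N : ℕ)
    (hN : N * τ a ≤ 1) {p : ℝ} (hp : p ∈ Icc (0:ℝ) 1) (hpM : p ∉ ρ.M) :
    N * |ρ.ll a p| ≤ |ρ.ll f p| := by
  have h1 : ρ.Cone f (N • a) := T.cone_of_nonneg (by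
    rw [map_nsmul]; exact nsmul_nonneg h0 N)
  have h2 : ρ.Cone f (f - N • a) := T.cone_of_nonneg (by
    rw [map_sub, map_nsmul, T.one, nsmul_eq_mul]; linarith)
  have h3 := ρ.chi_sign T.free h1 h2 hp hpM
  have h4 := ρ.ll_add_fix (f - N • a) (N • a) hp hpM
  rw [sub_add_cancel] at h4
  have h5 := ρ.ll_nsmul_fix a N hp hpM
  have h6 : (N:ℝ) * |ρ.ll a p| = |ρ.ll (N • a) p| := by
    rw [h5, abs_mul, Nat.abs_cast]
  rw [h6, h4]
  apply sq_le_sq.1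
  nlinarith [sq_nonneg (ρ.ll (f - N • a) p)]

lemma Tau.between (T : ρ.Tau f τ) {a : Fin d → ℤ} (h0 : 0 ≤ τ a) (h1 : τ a ≤ 1)
    {x : ℝ} (hx : x ∈ Icc (0:ℝ) 1) : ρ.act a x ∈ uIcc x (ρ.act f x) := by
  have ha := T.cone_of_nonneg h0
  have hb : ρ.Cone f (f - a) := T.cone_of_nonneg (by
    rw [map_sub, T.one]; linarith)
  have hcomp : ρ.act (f - a) (ρ.act a x) = ρ.act f x := by
    rw [← ρ.act_add, sub_add_cancel]
  rcases lt_trichotomy x (ρ.act f x) with h | h | h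
  · have h2 : ρ.act a x < ρ.act f (ρ.act a x) := by
      rw [ρ.act_comm]
      exact ρ.act_strictMono a h
    have h3 := (hb _).1 h2
    rw [hcomp] at h3
    exact mem_uIcc.2 (Or.inl ⟨(ha x).1 h, h3⟩)
  · have hxM : x ∉ ρ.M := fun h' => T.free x h' h.symm
    rw [ρ.fix_of_not_M hx hxM a]
    exact left_mem_uIcc
  · have h2 : ρ.act f (ρ.act a x) < ρ.act a x := by
      rw [ρ.act_comm]
      exact ρ.act_strictMono a h
    have h3 := (hb _).2 h2
    rw [hcomp] at h3
    exact mem_uIcc.2 (Or.inr ⟨h3, (ha x).2 h⟩)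

lemma Tau.boundA (T : ρ.Tau f τ) : ∃ C : ℝ, 0 ≤ C ∧ ∀ a, 0 ≤ τ a → τ a ≤ 1 →
    ∀ x ∈ Icc (0:ℝ) 1, |ρ.ll a x| ≤ C := by
  obtain ⟨C0, hC0⟩ := isCompact_Icc.exists_bound_of_continuousOn (ρ.ll_cont f)
  simp only [Real.norm_eq_abs] at hC0
  have hC0' : 0 ≤ C0 := (abs_nonneg _).trans (hC0 0 ⟨le_rfl, zero_le_one⟩)
  refine ⟨C0 + (eVariationOn (ρ.ll f) (Icc 0 1)).toReal, by positivity, fun a h0 h1 x hx => ?_⟩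
  obtain ⟨p, hp, hlim, hpM⟩ := ρ.seq_lim_not_M T.free hx
  have hd := ρ.dist_est f a hx left_mem_uIcc (T.between h0 h1 hx) hlim
  have hchi := T.chi_bound h0 1 (by simpa using h1) hp hpM
  have hv : (eVariationOn (ρ.ll f) (uIcc x p)).toReal ≤
      (eVariationOn (ρ.ll f) (Icc 0 1)).toReal :=
    ENNReal.toReal_mono (ρ.ll_bv f) (eVariationOn.mono _ (uIcc_subset_Icc hx hp))
  have h3 := hC0 p hp
  have h4 : |ρ.ll a x| ≤ |ρ.ll a x - ρ.ll a p| + |ρ.ll a p| := by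
    have := abs_add_le (ρ.ll a x - ρ.ll a p) (ρ.ll a p)
    rwa [sub_add_cancel] at this
  simp only [Nat.cast_one, one_mul] at hchi
  linarith

lemma Tau.boundB (T : ρ.Tau f τ) : ∃ C : ℝ, 0 < C ∧ ∀ a, 0 ≤ τ a → ∀ N : ℕ, N * τ a ≤ 1 →
    ∀ x ∈ Icc (0:ℝ) 1, N * |ρ.act a x - x| ≤ C := by
  obtain ⟨C, hC, hA⟩ := T.boundA
  refine ⟨Real.exp C, Real.exp_pos C, fun a h0 N hN x hx => ?_⟩
  have hstep : ∀ k ∈ Finset.range N, Real.exp (-C) * |ρ.act a x - x| ≤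
      |ρ.act ((k+1) • a) x - ρ.act (k • a) x| := by
    intro k hk
    have hk' : (k:ℝ) ≤ N := by exact_mod_cast (Finset.mem_range.1 hk).le
    have hk0 : 0 ≤ τ (k • a) := by rw [map_nsmul]; exact nsmul_nonneg h0 k
    have hk1 : τ (k • a) ≤ 1 := by
      rw [map_nsmul, nsmul_eq_mul]
      nlinarith
    have := ρ.mvt_lower' (k • a) hx (ρ.act_mem a hx) (c := Real.exp (-C)) (fun w hw => by
      have hwI : w ∈ Icc (0:ℝ) 1 := uIcc_subset_Icc hx (ρ.act_mem a hx) hw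
      rw [← ρ.exp_ll _ hwI]
      exact Real.exp_le_exp.2 (abs_le.1 (hA _ hk0 hk1 w hwI)).1)
    rwa [← ρ.act_add, ← succ_nsmul] at this
  have hsum : ∑ k ∈ Finset.range N, |ρ.act ((k+1) • a) x - ρ.act (k • a) x| ≤ 1 := by
    have hN1 := ρ.act_mem (N • a) hx
    rcases ρ.seq_mono_or a x with h | h
    · rw [Finset.sum_congr rfl fun k _ => abs_of_nonneg (sub_nonneg.2 (h (Nat.le_succ k))),
        Finset.sum_range_sub (fun k => ρ.act (k • a) x), zero_smul, ρ.act_zero]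
      linarith [hN1.2, hx.1]
    · rw [Finset.sum_congr rfl fun k _ => (abs_of_nonpos (sub_nonpos.2 (h (Nat.le_succ k)))).trans
        (neg_sub _ _), Finset.sum_range_sub' (fun k => ρ.act (k • a) x), zero_smul, ρ.act_zero]
      linarith [hN1.1, hx.2]
  have h1 := (Finset.sum_le_sum hstep).trans hsum
  rw [Finset.sum_const, Finset.card_range, nsmul_eq_mul] at h1
  have h2 := mul_le_mul_of_nonneg_left h1 (Real.exp_pos C).le
  have h3 : Real.exp C * Real.exp (-C) = 1 := by rw [← Real.exp_add, add_neg_cancel, Real.exp_zero]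
  calc N * |ρ.act a x - x| = (Real.exp C * Real.exp (-C)) * (N * |ρ.act a x - x|) := by
        rw [h3, one_mul]
    _ = Real.exp C * (N * (Real.exp (-C) * |ρ.act a x - x|)) := by ring
    _ ≤ Real.exp C := by simpa using h2

end ZdAction1bv

namespace ZdAction1bv

variable {d : ℕ} (ρ : ZdAction1bv d)

lemma var_small (g : Fin d → ℤ) {x₀ : ℝ} (hx₀ : x₀ ∈ Icc (0:ℝ) 1) {ε : ℝ} (hε : 0 < ε) :
    ∀ᶠ z in 𝓝[Icc (0:ℝ) 1] x₀, (eVariationOn (ρ.ll g) (uIcc x₀ z)).toReal < ε := by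
  have hc : ContinuousWithinAt (ρ.ll g) (Icc (0:ℝ) 1) x₀ := ρ.ll_cont g x₀ hx₀
  have h1 := (ρ.ll_bv g).tendsto_eVariationOn_Icc_zero_left (hc.mono inter_subset_left)
  have h2 := (ρ.ll_bv g).tendsto_eVariationOn_Icc_zero_right x₀ (hc.mono inter_subset_left)
  have hε' : (0 : ENNReal) < ENNReal.ofReal ε := ENNReal.ofReal_pos.2 hε
  filter_upwards [h1.eventually (gt_mem_nhds hε'), h2.eventually (gt_mem_nhds hε'),
    self_mem_nhdsWithin] with z hz1 hz2 hz
  have hlt : eVariationOn (ρ.ll g) (uIcc x₀ z) < ENNReal.ofReal ε := by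
    rcases le_total x₀ z with h | h
    · rw [uIcc_of_le h]
      rwa [inter_eq_right.2 (Icc_subset_Icc hx₀.1 hz.2)] at hz2
    · rw [uIcc_of_ge h]
      rwa [inter_eq_right.2 (Icc_subset_Icc hz.1 hx₀.2)] at hz1
  exact (ENNReal.lt_ofReal_iff_toReal_lt hlt.ne_top).1 hlt

lemma toward {F : Fin d → ℤ} (hF : ∀ x ∈ ρ.M, ρ.act F x ≠ x) {x₀ z x : ℝ}
    (hx₀ : x₀ ∈ Icc (0:ℝ) 1) (hx₀M : x₀ ∉ ρ.M) (hz : z ∈ Icc (0:ℝ) 1)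
    (h : (x₀ ≤ z ∧ ρ.act F z ≤ z) ∨ (z ≤ x₀ ∧ z ≤ ρ.act F z)) {a : Fin d → ℤ}
    (hx : x ∈ uIcc z (ρ.act F z)) (hy : ρ.act a x ∈ uIcc z (ρ.act F z)) :
    ∃ p ∈ Icc (0:ℝ) 1, p ∉ ρ.M ∧
      |ρ.ll a x - ρ.ll a p| ≤ (eVariationOn (ρ.ll F) (uIcc x₀ z)).toReal := by
  obtain ⟨p, hp, hlim, hpM⟩ := ρ.seq_lim_not_M hF hz
  refine ⟨p, hp, hpM, (ρ.dist_est F a hz hx hy hlim).trans ?_⟩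
  have hpu : p ∈ uIcc x₀ z := by
    rcases h with ⟨h1, h2⟩ | ⟨h1, h2⟩
    · refine mem_uIcc.2 (Or.inl ⟨ge_of_tendsto' hlim fun n => ?_, ?_⟩)
      · have := (ρ.act_strictMono (n • F)).monotone h1
        rwa [ρ.fix_of_not_M hx₀ hx₀M] at this
      · have := (ρ.seq_anti F h2).le_of_tendsto hlim 0
        simpa [ρ.act_zero] using this
    · refine mem_uIcc.2 (Or.inr ⟨?_, le_of_tendsto' hlim fun n => ?_⟩)
      · have := (ρ.seq_mono F h2).ge_of_tendsto hlim 0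
        simpa [ρ.act_zero] using this
      · have := (ρ.act_strictMono (n • F)).monotone h1
        rwa [ρ.fix_of_not_M hx₀ hx₀M] at this
  have hsub : uIcc z p ⊆ uIcc x₀ z := uIcc_subset_uIcc right_mem_uIcc hpu
  have hbv : eVariationOn (ρ.ll F) (uIcc x₀ z) ≠ ⊤ :=
    (ρ.ll_bv F).mono (uIcc_subset_Icc hx₀ hz)
  exact ENNReal.toReal_mono hbv (eVariationOn.mono _ hsub)

variable {ρ} {f : Fin d → ℤ} {τ : (Fin d → ℤ) →+ ℝ}

lemma Tau.toward' (T : ρ.Tau f τ) {x₀ x : ℝ} (hx₀ : x₀ ∈ Icc (0:ℝ) 1) (hx₀M : x₀ ∉ ρ.M)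
    (hx : x ∈ Icc (0:ℝ) 1) {a : Fin d → ℤ} (h0 : 0 ≤ τ a) (h1 : τ a ≤ 1) :
    ∃ p ∈ Icc (0:ℝ) 1, p ∉ ρ.M ∧
      (|ρ.ll a x - ρ.ll a p| ≤ (eVariationOn (ρ.ll f) (uIcc x₀ x)).toReal ∨
      |ρ.ll a x - ρ.ll a p| ≤ (eVariationOn (ρ.ll (-f)) (uIcc x₀ (ρ.act f x))).toReal) := by
  have hb := T.between h0 h1 hx
  have hF : ∀ x ∈ ρ.M, ρ.act (-f) x ≠ x := by
    intro x hx h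
    apply T.free x hx
    conv_lhs => rw [← h]
    exact ρ.act_act_neg f x
  by_cases h : (x₀ ≤ x ∧ ρ.act f x ≤ x) ∨ (x ≤ x₀ ∧ x ≤ ρ.act f x)
  · obtain ⟨p, hp, hpM, hle⟩ := ρ.toward T.free hx₀ hx₀M hx h left_mem_uIcc hb
    exact ⟨p, hp, hpM, Or.inl hle⟩
  · have hfx := ρ.fix_of_not_M hx₀ hx₀M f
    have h' : (x₀ ≤ ρ.act f x ∧ ρ.act (-f) (ρ.act f x) ≤ ρ.act f x) ∨
        (ρ.act f x ≤ x₀ ∧ ρ.act f x ≤ ρ.act (-f) (ρ.act f x)) := by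
      rw [ρ.act_neg_act]
      rcases le_total x₀ x with h2 | h2
      · left
        have := (ρ.act_strictMono f).monotone h2
        rw [hfx] at this
        exact ⟨this, le_of_lt (not_le.1 fun h3 => h (Or.inl ⟨h2, h3⟩))⟩
      · right
        have := (ρ.act_strictMono f).monotone h2
        rw [hfx] at this
        exact ⟨this, le_of_lt (not_le.1 fun h3 => h (Or.inr ⟨h2, h3⟩))⟩
    obtain ⟨p, hp, hpM, hle⟩ := ρ.toward hF hx₀ hx₀M (ρ.act_mem f hx) h' (x := x) (a := a)
      (by rw [ρ.act_neg_act]; exact right_mem_uIcc)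
      (by rw [ρ.act_neg_act, uIcc_comm]; exact hb)
    exact ⟨p, hp, hpM, Or.inr hle⟩

lemma Tau.keyC1 (T : ρ.Tau f τ) {x₀ : ℝ} (hx₀ : x₀ ∈ Icc (0:ℝ) 1) (hx₀M : x₀ ∉ ρ.M)
    {ε : ℝ} (hε : 0 < ε) : ∃ U ∈ 𝓝[Icc (0:ℝ) 1] x₀, ∃ δ > (0:ℝ), ∀ a, 0 ≤ τ a → τ a < δ →
      ∀ x ∈ U ∩ Icc (0:ℝ) 1, |ρ.ll a x| < ε := by
  obtain ⟨C0, hC0⟩ := isCompact_Icc.exists_bound_of_continuousOn (ρ.ll_cont f)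
  simp only [Real.norm_eq_abs] at hC0
  have hC0' : 0 ≤ C0 := (abs_nonneg _).trans (hC0 0 ⟨le_rfl, zero_le_one⟩)
  obtain ⟨N, hN⟩ := exists_nat_gt (C0 / (ε / 2))
  have hN0 : (0:ℝ) < N := lt_of_le_of_lt (by positivity) hN
  have hN1 : (1:ℝ) ≤ N := by exact_mod_cast (Nat.cast_pos.1 hN0)
  rw [div_lt_iff₀ (by positivity)] at hN
  have e1 := ρ.var_small f hx₀ (half_pos hε)
  have hcont : Tendsto (ρ.act f) (𝓝[Icc (0:ℝ) 1] x₀) (𝓝[Icc (0:ℝ) 1] x₀) := by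
    have := ((ρ.act_continuous f).continuousWithinAt (s := Icc (0:ℝ) 1) (x := x₀)).tendsto_nhdsWithin
      (fun y hy => ρ.act_mem f hy)
    rwa [ρ.fix_of_not_M hx₀ hx₀M] at this
  have e2 := hcont.eventually (ρ.var_small (-f) hx₀ (half_pos hε))
  refine ⟨_, e1.and e2, 1 / N, by positivity, fun a h0 hδ x hx => ?_⟩
  obtain ⟨⟨v1, v2⟩, hxI⟩ := hx
  have hNa : N * τ a ≤ 1 := by
    rw [lt_div_iff₀ hN0] at hδ
    linarith
  have ha1 : τ a ≤ 1 := by nlinarith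
  obtain ⟨p, hp, hpM, hle⟩ := T.toward' hx₀ hx₀M hxI h0 ha1
  have hd : |ρ.ll a x - ρ.ll a p| < ε / 2 := by
    rcases hle with h | h
    · exact lt_of_le_of_lt h v1
    · exact lt_of_le_of_lt h v2
  have hchi := (T.chi_bound h0 N hNa hp hpM).trans (hC0 p hp)
  have hlp : |ρ.ll a p| < ε / 2 := by
    by_contra hcon
    have := mul_le_mul_of_nonneg_left (not_lt.1 hcon) hN0.le
    linarith
  have h4 : |ρ.ll a x| ≤ |ρ.ll a x - ρ.ll a p| + |ρ.ll a p| := by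
    have := abs_add_le (ρ.ll a x - ρ.ll a p) (ρ.ll a p)
    rwa [sub_add_cancel] at this
  linarith

lemma Tau.keyD (T : ρ.Tau f τ) {ε : ℝ} (hε : 0 < ε) : ∃ δ > (0:ℝ), ∀ a, |τ a| < δ →
    ∀ x ∈ Icc (0:ℝ) 1, |ρ.act a x - x| < ε := by
  obtain ⟨C, hC, hB⟩ := T.boundB
  obtain ⟨N, hN⟩ := exists_nat_gt (C / ε)
  have hN0 : (0:ℝ) < N := lt_of_le_of_lt (by positivity) hN
  rw [div_lt_iff₀ (by positivity)] at hN
  have key : ∀ a, 0 ≤ τ a → τ a < 1 / N → ∀ x ∈ Icc (0:ℝ) 1, |ρ.act a x - x| < ε := by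
    intro a h0 hδ x hx
    rw [lt_div_iff₀ hN0] at hδ
    have := hB a h0 N (by linarith) x hx
    by_contra hcon
    have := mul_le_mul_of_nonneg_left (not_lt.1 hcon) hN0.le
    linarith
  refine ⟨1 / N, by positivity, fun a ha x hx => ?_⟩
  rw [abs_lt] at ha
  rcases le_total 0 (τ a) with h | h
  · exact key a h ha.2 x hx
  · have := key (-a) (by rw [map_neg]; linarith) (by rw [map_neg]; linarith) _ (ρ.act_mem a hx)
    rwa [ρ.act_neg_act, abs_sub_comm] at this

lemma Tau.keyC2 (T : ρ.Tau f τ) {x₀ : ℝ} (hx₀ : x₀ ∈ Icc (0:ℝ) 1)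
    {ε : ℝ} (hε : 0 < ε) : ∃ U ∈ 𝓝[Icc (0:ℝ) 1] x₀, ∃ δ > (0:ℝ), ∀ a, 0 ≤ τ a → τ a < δ →
      ∀ x ∈ U ∩ Icc (0:ℝ) 1, |ρ.ll a x| < ε := by
  obtain ⟨p, hp, hlim, hpM⟩ := ρ.seq_lim_not_M T.free hx₀
  obtain ⟨U, hU, δ₁, hδ₁, hU'⟩ := T.keyC1 hp hpM (half_pos hε)
  rw [← eventually_mem_set, ← eventually_eventually_nhdsWithin] at hU
  have hlim' : Tendsto (fun n : ℕ => ρ.act (n • f) x₀) atTop (𝓝[Icc (0:ℝ) 1] p) :=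
    tendsto_nhdsWithin_iff.2 ⟨hlim, Eventually.of_forall fun n => ρ.act_mem _ hx₀⟩
  obtain ⟨n, hn⟩ := (hlim'.eventually hU).exists
  have hcont : Tendsto (ρ.act (n • f)) (𝓝[Icc (0:ℝ) 1] x₀)
      (𝓝[Icc (0:ℝ) 1] (ρ.act (n • f) x₀)) :=
    ((ρ.act_continuous _).continuousWithinAt (s := Icc (0:ℝ) 1) (x := x₀)).tendsto_nhdsWithin
      (fun y hy => ρ.act_mem _ hy)
  have huc := isCompact_Icc.uniformContinuousOn_of_continuous (ρ.ll_cont (n • f))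
  obtain ⟨η, hη, huc'⟩ := Metric.uniformContinuousOn_iff.1 huc _ (half_pos hε)
  obtain ⟨δ₂, hδ₂, hD⟩ := T.keyD hη
  refine ⟨_, hcont.eventually hn, min δ₁ δ₂, lt_min hδ₁ hδ₂, fun a h0 ha x hx => ?_⟩
  obtain ⟨hxU, hxI⟩ := hx
  have g1 := hU' a h0 (ha.trans_le (min_le_left _ _)) _ ⟨hxU, ρ.act_mem _ hxI⟩
  have g2 := hD a (by rw [abs_of_nonneg h0]; exact ha.trans_le (min_le_right _ _)) x hxI
  have g3 := huc' _ (ρ.act_mem a hxI) _ hxI (by rwa [Real.dist_eq])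
  rw [Real.dist_eq] at g3
  have e1 := ρ.ll_add a (n • f) hxI
  have e2 := ρ.ll_add (n • f) a hxI
  rw [add_comm] at e2
  have e3 : ρ.ll a x = ρ.ll a (ρ.act (n • f) x) -
      (ρ.ll (n • f) (ρ.act a x) - ρ.ll (n • f) x) := by linarith
  rw [e3]
  calc _ ≤ |ρ.ll a (ρ.act (n • f) x)| + |ρ.ll (n • f) (ρ.act a x) - ρ.ll (n • f) x| := abs_sub _ _
    _ < ε := by linarith

lemma Tau.keyC (T : ρ.Tau f τ) {ε : ℝ} (hε : 0 < ε) : ∃ δ > (0:ℝ), ∀ a, |τ a| < δ →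
    ∀ x ∈ Icc (0:ℝ) 1, |ρ.ll a x| < ε := by
  have key : ∃ δ > (0:ℝ), ∀ a, 0 ≤ τ a → τ a < δ →
      ∀ x ∈ Icc (0:ℝ) 1 ∩ Icc (0:ℝ) 1, |ρ.ll a x| < ε := by
    apply (isCompact_Icc (a := (0:ℝ)) (b := 1)).induction_on
      (p := fun s => ∃ δ > (0:ℝ), ∀ a, 0 ≤ τ a → τ a < δ →
        ∀ x ∈ s ∩ Icc (0:ℝ) 1, |ρ.ll a x| < ε)
    · exact ⟨1, one_pos, fun a _ _ x hx => hx.1.elim⟩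
    · rintro s t hst ⟨δ, hδ, h⟩
      exact ⟨δ, hδ, fun a h0 h1 x hx => h a h0 h1 x ⟨hst hx.1, hx.2⟩⟩
    · rintro s t ⟨δ, hδ, h⟩ ⟨δ', hδ', h'⟩
      refine ⟨min δ δ', lt_min hδ hδ', fun a h0 h1 x hx => ?_⟩
      rcases hx.1 with hs | ht
      · exact h a h0 (h1.trans_le (min_le_left _ _)) x ⟨hs, hx.2⟩
      · exact h' a h0 (h1.trans_le (min_le_right _ _)) x ⟨ht, hx.2⟩
    · intro x hx
      exact T.keyC2 hx hε
  obtain ⟨δ, hδ, h⟩ := key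
  refine ⟨δ, hδ, fun a ha x hx => ?_⟩
  rw [abs_lt] at ha
  rcases le_total 0 (τ a) with h0 | h0
  · exact h a h0 ha.2 x ⟨hx, hx⟩
  · have h2 := ρ.act_mem a hx
    have := h (-a) (by rw [map_neg]; linarith) (by rw [map_neg]; linarith) _ ⟨h2, h2⟩
    rwa [ρ.ll_neg a h2, ρ.act_neg_act, abs_neg] at this

/-- Uniform modulus of continuity for the action in terms of `τ`. -/
lemma Tau.modulus (T : ρ.Tau f τ) {ε : ℝ} (hε : 0 < ε) : ∃ δ > (0:ℝ), ∀ a b, |τ a - τ b| < δ →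
    ∀ x ∈ Icc (0:ℝ) 1, |ρ.act a x - ρ.act b x| < ε ∧ |ρ.ll a x - ρ.ll b x| < ε := by
  obtain ⟨δ₁, hδ₁, h1⟩ := T.keyC hε
  obtain ⟨δ₂, hδ₂, h2⟩ := T.keyD hε
  refine ⟨min δ₁ δ₂, lt_min hδ₁ hδ₂, fun a b hab x hx => ?_⟩
  rw [← map_sub] at hab
  have hb := ρ.act_mem b hx
  have g1 := h1 _ (hab.trans_le (min_le_left _ _)) _ hb
  have g2 := h2 _ (hab.trans_le (min_le_right _ _)) _ hb
  rw [← ρ.act_add, sub_add_cancel] at g2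
  have e := ρ.ll_add (a - b) b hx
  rw [sub_add_cancel] at e
  refine ⟨g2, ?_⟩
  rw [e, add_sub_cancel_right]
  exact g1

end ZdAction1bv

namespace ZdAction1bv

variable {d : ℕ} {ρ : ZdAction1bv d} {f : Fin d → ℤ} {τ : (Fin d → ℤ) →+ ℝ}

lemma comap_tau_neBot (hd : DenseRange τ) (t : ℝ) : (comap τ (𝓝 t)).NeBot := by
  rw [comap_neBot_iff]
  intro s hs
  obtain ⟨y, hy, ⟨a, rfl⟩⟩ := mem_closure_iff_nhds.1 (hd t) s hs
  exact ⟨a, hy⟩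

lemma eventually_close (t : ℝ) {δ : ℝ} (hδ : 0 < δ) :
    ∀ᶠ a in comap τ (𝓝 t), |τ a - t| < δ := by
  have h : ∀ᶠ s in 𝓝 t, |s - t| < δ := by
    have := Metric.ball_mem_nhds t hδ
    filter_upwards [this] with s hs
    rwa [Metric.mem_ball, Real.dist_eq] at hs
  exact tendsto_comap.eventually h

lemma exists_lim (hd : DenseRange τ) (u : (Fin d → ℤ) → ℝ)
    (hu : ∀ ε > (0:ℝ), ∃ δ > (0:ℝ), ∀ a b, |τ a - τ b| < δ → |u a - u b| < ε) (t : ℝ) :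
    ∃ L, Tendsto u (comap τ (𝓝 t)) (𝓝 L) := by
  have hne := comap_tau_neBot hd t
  have hc : Cauchy (map u (comap τ (𝓝 t))) := by
    rw [Metric.cauchy_iff]
    refine ⟨hne.map u, fun ε hε => ?_⟩
    obtain ⟨δ, hδ, h⟩ := hu ε hε
    refine ⟨u '' {a | |τ a - t| < δ / 2}, image_mem_map (eventually_close t (half_pos hδ)), ?_⟩
    rintro _ ⟨a, ha, rfl⟩ _ ⟨b, hb, rfl⟩
    rw [Real.dist_eq]
    apply h
    have : τ a - τ b = (τ a - t) - (τ b - t) := by ring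
    rw [this]
    calc _ ≤ |τ a - t| + |τ b - t| := abs_sub _ _
      _ < δ := by
        simp only [mem_ofPred_eq] at ha hb
        linarith
  exact CompleteSpace.complete hc

lemma Tau.flow (T : ρ.Tau f τ) (hd : DenseRange τ) :
    ∃ Φ Φ' : ℝ → ℝ → ℝ, IsC1FlowOn (Icc (0:ℝ) 1) Φ Φ' ∧
      ∀ a : Fin d → ℤ, ∃ t : ℝ, ∀ x : ℝ, ρ.act a x = Φ t x := by
  have hne := comap_tau_neBot hd
  have exΦ : ∀ t x, ∃ L, Tendsto (fun a => ρ.act a x) (comap τ (𝓝 t)) (𝓝 L) := by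
    intro t x
    by_cases hx : x ∈ Icc (0:ℝ) 1
    · refine exists_lim hd _ (fun ε hε => ?_) t
      obtain ⟨δ, hδ, h⟩ := T.modulus hε
      exact ⟨δ, hδ, fun a b hab => (h a b hab x hx).1⟩
    · refine ⟨x, tendsto_const_nhds.congr fun a => (ρ.act_outside a hx).symm⟩
  have exΛ : ∀ t x, ∃ L, x ∈ Icc (0:ℝ) 1 →
      Tendsto (fun a => ρ.ll a x) (comap τ (𝓝 t)) (𝓝 L) := by
    intro t x
    by_cases hx : x ∈ Icc (0:ℝ) 1
    · obtain ⟨L, hL⟩ := exists_lim hd (fun a => ρ.ll a x) (fun ε hε => by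
        obtain ⟨δ, hδ, h⟩ := T.modulus hε
        exact ⟨δ, hδ, fun a b hab => (h a b hab x hx).2⟩) t
      exact ⟨L, fun _ => hL⟩
    · exact ⟨0, fun h => (hx h).elim⟩
  choose Φ hΦ using exΦ
  choose Λ hΛ using exΛ
  -- uniform closeness to the action
  have close : ∀ ε > (0:ℝ), ∃ δ > (0:ℝ), ∀ t a, |τ a - t| < δ → ∀ x ∈ Icc (0:ℝ) 1,
      |Φ t x - ρ.act a x| ≤ ε ∧ |Λ t x - ρ.ll a x| ≤ ε := by
    intro ε hε
    obtain ⟨δ, hδ, h⟩ := T.modulus hε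
    refine ⟨δ / 2, half_pos hδ, fun t a ha x hx => ?_⟩
    have hev : ∀ᶠ b in comap τ (𝓝 t), |τ b - τ a| < δ := by
      filter_upwards [eventually_close t (half_pos hδ)] with b hb
      have : τ b - τ a = (τ b - t) - (τ a - t) := by ring
      rw [this]
      calc _ ≤ |τ b - t| + |τ a - t| := abs_sub _ _
        _ < δ := by linarith
    constructor
    · exact le_of_tendsto ((hΦ t x).sub_const _).abs (hev.mono fun b hb => (h b a hb x hx).1.le)
    · exact le_of_tendsto ((hΛ t x hx).sub_const _).abs (hev.mono fun b hb => (h b a hb x hx).2.le)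
  have close2 : ∀ ε > (0:ℝ), ∃ δ > (0:ℝ), ∀ t t₀, |t - t₀| < δ → ∀ x ∈ Icc (0:ℝ) 1,
      |Φ t x - Φ t₀ x| ≤ ε ∧ |Λ t x - Λ t₀ x| ≤ ε := by
    intro ε hε
    obtain ⟨δ, hδ, h⟩ := close ε hε
    refine ⟨δ / 2, half_pos hδ, fun t t₀ ha x hx => ?_⟩
    have hev : ∀ᶠ b in comap τ (𝓝 t₀), |τ b - t| < δ := by
      filter_upwards [eventually_close t₀ (half_pos hδ)] with b hb
      have : τ b - t = (τ b - t₀) - (t - t₀) := by ring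
      rw [this]
      calc _ ≤ |τ b - t₀| + |t - t₀| := abs_sub _ _
        _ < δ := by linarith
    constructor
    · exact le_of_tendsto ((hΦ t₀ x).const_sub _).abs (hev.mono fun b hb => (h t b hb x hx).1)
    · exact le_of_tendsto ((hΛ t₀ x hx).const_sub _).abs (hev.mono fun b hb => (h t b hb x hx).2)
  have hout : ∀ t, ∀ x ∉ Icc (0:ℝ) 1, Φ t x = x := by
    intro t x hx
    exact tendsto_nhds_unique (hΦ t x)
      (tendsto_const_nhds.congr fun a => (ρ.act_outside a hx).symm)
  have hτ : ∀ a x, Φ (τ a) x = ρ.act a x := by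
    intro a x
    by_cases hx : x ∈ Icc (0:ℝ) 1
    · apply eq_of_abs_sub_nonpos
      refine le_of_forall_pos_le_add fun ε hε => ?_
      obtain ⟨δ, hδ, h⟩ := close ε hε
      rw [zero_add]
      exact (h (τ a) a (by simpa using hδ) x hx).1
    · rw [hout _ x hx, ρ.act_outside a hx]
  have hmem : ∀ t, ∀ x ∈ Icc (0:ℝ) 1, Φ t x ∈ Icc (0:ℝ) 1 := by
    intro t x hx
    exact isClosed_Icc.mem_of_tendsto (hΦ t x) (Eventually.of_forall fun a => ρ.act_mem a hx)
  have hΛc : ∀ t, ContinuousOn (Λ t) (Icc (0:ℝ) 1) := by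
    intro t
    apply continuousOn_of_uniform_approx_of_continuousOn
    intro u hu
    obtain ⟨ε, hε, hεu⟩ := Metric.mem_uniformity_dist.1 hu
    obtain ⟨δ, hδ, h⟩ := close (ε / 2) (half_pos hε)
    obtain ⟨a, ha⟩ := (eventually_close (τ := τ) t hδ).exists
    refine ⟨ρ.ll a, ρ.ll_cont a, fun y hy => hεu ?_⟩
    rw [Real.dist_eq]
    linarith [(h t a ha y hy).2]
  have hderiv : ∀ t, ∀ x ∈ Icc (0:ℝ) 1,
      HasDerivWithinAt (Φ t) (Real.exp (Λ t x)) (Icc (0:ℝ) 1) x := by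
    intro t x hx
    rw [hasDerivWithinAt_iff_isLittleO, Asymptotics.isLittleO_iff]
    intro ε hε
    obtain ⟨η, hη, hexp⟩ := Metric.continuousAt_iff.1
      (Real.continuous_exp.continuousAt (x := Λ t x)) ε hε
    obtain ⟨r, hr, hcr⟩ := Metric.continuousWithinAt_iff.1 (hΛc t x hx) (η / 2) (half_pos hη)
    obtain ⟨δ, hδ, h⟩ := close (η / 4) (by positivity)
    rw [eventually_iff_exists_mem]
    refine ⟨Icc (0:ℝ) 1 ∩ Metric.ball x r, inter_mem self_mem_nhdsWithin
      (mem_nhdsWithin_of_mem_nhds (Metric.ball_mem_nhds x hr)), fun y hy => ?_⟩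
    have hxB : x ∈ Icc (0:ℝ) 1 ∩ Metric.ball x r := ⟨hx, Metric.mem_ball_self hr⟩
    have hlim : Tendsto (fun a => ‖ρ.act a y - ρ.act a x - (y - x) • Real.exp (Λ t x)‖)
        (comap τ (𝓝 t)) (𝓝 ‖Φ t y - Φ t x - (y - x) • Real.exp (Λ t x)‖) :=
      (((hΦ t y).sub (hΦ t x)).sub_const _).norm
    refine le_of_tendsto hlim ?_
    filter_upwards [eventually_close t hδ] with a ha
    have hbd : ∀ w ∈ Icc (0:ℝ) 1 ∩ Metric.ball x r, ‖ρ.dd a w - Real.exp (Λ t x)‖ ≤ ε := by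
      intro w hw
      rw [← ρ.exp_ll a hw.1, ← dist_eq_norm]
      refine (hexp ?_).le
      have e1 := (h t a ha w hw.1).2
      have e2 := hcr hw.1 hw.2
      rw [Real.dist_eq] at e2 ⊢
      have e3 : ρ.ll a w - Λ t x = (Λ t w - Λ t x) - (Λ t w - ρ.ll a w) := by ring
      rw [e3]
      calc _ ≤ |Λ t w - Λ t x| + |Λ t w - ρ.ll a w| := abs_sub _ _
        _ < η := by linarith
    have hg : ∀ w ∈ Icc (0:ℝ) 1 ∩ Metric.ball x r,
        HasDerivWithinAt (fun w => ρ.act a w - w * Real.exp (Λ t x))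
          (ρ.dd a w - Real.exp (Λ t x)) (Icc (0:ℝ) 1 ∩ Metric.ball x r) w := by
      intro w hw
      have e1 := (ρ.hasDeriv a hw.1).mono (inter_subset_left (t := Metric.ball x r))
      have e2 := (hasDerivWithinAt_id w (Icc (0:ℝ) 1 ∩ Metric.ball x r)).mul_const
        (Real.exp (Λ t x))
      rw [one_mul] at e2
      exact e1.sub e2
    have hmv := ((convex_Icc (0:ℝ) 1).inter (convex_ball x r)).norm_image_sub_le_of_norm_hasDerivWithin_le
      hg hbd hxB hy
    refine le_trans (le_of_eq ?_) hmv
    congr 1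
    rw [smul_eq_mul]
    ring
  have hΦc : ∀ t, ContinuousOn (Φ t) (Icc (0:ℝ) 1) := fun t x hx =>
    (hderiv t x hx).continuousWithinAt
  have hgrp0 : ∀ t b x, Φ (t + τ b) x = Φ t (ρ.act b x) := by
    intro t b x
    have h1 : Tendsto (fun a => a + b) (comap τ (𝓝 t)) (comap τ (𝓝 (t + τ b))) := by
      rw [tendsto_comap_iff]
      have : (τ ∘ fun a => a + b) = fun a => τ a + τ b := by
        ext a
        simp
      rw [this]
      exact (tendsto_comap (f := τ) (x := 𝓝 t)).add_const (τ b)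
    have h2 := (hΦ (t + τ b) x).comp h1
    refine tendsto_nhds_unique (h2.congr fun a => ?_) (hΦ t (ρ.act b x))
    exact ρ.act_add a b x
  have hgrp : ∀ t u x, Φ (t + u) x = Φ t (Φ u x) := by
    intro t u x
    by_cases hx : x ∈ Icc (0:ℝ) 1
    · have h1 : Tendsto (fun b => Φ t (ρ.act b x)) (comap τ (𝓝 u)) (𝓝 (Φ t (Φ u x))) :=
        (hΦc t _ (hmem u x hx)).tendsto.comp (tendsto_nhdsWithin_iff.2
          ⟨hΦ u x, Eventually.of_forall fun b => ρ.act_mem b hx⟩)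
      have h2 : Tendsto (fun b => Φ (t + τ b) x) (comap τ (𝓝 u)) (𝓝 (Φ (t + u) x)) := by
        rw [Metric.tendsto_nhds]
        intro ε hε
        obtain ⟨δ, hδ, h⟩ := close2 (ε / 2) (half_pos hε)
        filter_upwards [eventually_close u hδ] with b hb
        rw [Real.dist_eq]
        have := (h (t + τ b) (t + u) (by rwa [add_sub_add_left_eq_sub]) x hx).1
        linarith
      exact tendsto_nhds_unique h2 (h1.congr fun b => (hgrp0 t b x).symm)
    · rw [hout _ x hx, hout u x hx, hout t x hx]
  have hzero : ∀ x, Φ 0 x = x := by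
    intro x
    have := hτ 0 x
    rwa [map_zero, ρ.act_zero] at this
  refine ⟨Φ, fun t x => Real.exp (Λ t x), ⟨hzero, hgrp, hout, fun t => ?_, hderiv, fun t => ?_,
    fun t x _ => Real.exp_pos _, ?_⟩, fun a => ⟨τ a, fun x => (hτ a x).symm⟩⟩
  · refine InvOn.bijOn (f' := Φ (-t)) ⟨fun x _ => ?_, fun x _ => ?_⟩ (hmem t) (hmem (-t))
    · rw [← hgrp, neg_add_cancel, hzero]
    · rw [← hgrp, add_neg_cancel, hzero]
  · exact Real.continuous_exp.comp_continuousOn (hΛc t)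
  · intro t₀ K _ hK ε hε
    obtain ⟨δ, hδ, h⟩ := close2 (ε / 3) (by positivity)
    refine ⟨δ, hδ, fun t ht x hx => ?_⟩
    rw [Real.log_exp, Real.log_exp]
    have := h t t₀ ht x (hK hx)
    linarith [this.1, this.2]

end ZdAction1bv

/-- If a `C^{1+bv}` action of `ℤᵈ` on `[0,1]` has no parabolic global fixed point in the open
interval `(0,1)` and its image group is not cyclic, then it embeds into a `C¹` flow. -/
theorem noncyclic_C1bv_action_embeds_in_C1_flow (d : ℕ) (ρ : ZdAction1bv d)
    (hnp : ∀ p ∈ Ioo (0:ℝ) 1,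
      ¬ ((∀ a : Fin d → ℤ, (ρ.elt a).toFun p = p) ∧
         (∀ a : Fin d → ℤ, (ρ.elt a).derivFun p = 1)))
    (hnc : ¬ ∃ c : Fin d → ℤ, ∀ a : Fin d → ℤ, ∃ n : ℤ, ∀ x : ℝ,
      (ρ.elt a).toFun x = (ρ.elt (n • c)).toFun x) :
    ∃ Φ Φ' : ℝ → ℝ → ℝ, IsC1FlowOn (Icc (0:ℝ) 1) Φ Φ' ∧
      ∀ a : Fin d → ℤ, ∃ t : ℝ, ∀ x : ℝ, (ρ.elt a).toFun x = Φ t x := by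
  have hNP : ρ.NoPar := by
    intro p hp hpM
    have hfix := ρ.fix_of_not_M (Ioo_subset_Icc_self hp) hpM
    have h1 : ¬ ∀ a : Fin d → ℤ, (ρ.elt a).derivFun p = 1 := fun h => hnp p hp ⟨hfix, h⟩
    push Not at h1
    obtain ⟨h, hh⟩ := h1
    exact ⟨h, Real.log_ne_zero_of_pos_of_ne_one (ρ.dd_pos h (Ioo_subset_Icc_self hp)) hh⟩
  have hex : ∃ g, ¬ ∀ x, ρ.act g x = x := by
    by_contra hcon
    push Not at hcon
    exact hnc ⟨0, fun a => ⟨0, fun x => (hcon a x).trans (hcon _ x).symm⟩⟩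
  obtain ⟨g, hg⟩ := hex
  have hfree := (ρ.trivial_or_free hNP g).resolve_left hg
  push Not at hg
  obtain ⟨x₀, hx₀⟩ := hg
  obtain ⟨τ, T⟩ := ρ.exists_tau hNP hfree (ρ.mem_M_of_moved hx₀)
  exact T.flow (ρ.tau_dense T hnc)
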